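/- Let Σ be a surface of constant mean curvature H in a Bianchi–Cartan–Vranceanu space M³_{m,l}, with adapted orthonormal frame {e₁ = a₁^γ E_γ, e₂ = a₂^γ E_γ, ξ = c^γ E_γ}, where ξ is the unit normal. Then (Ric(ξ))^⊤ = (l² − 4m)c³ Σᵢ aᵢ³ eᵢ and Ric(ξ,ξ) = (4m − l²/2) + (l² − 4m)(c³)², and consequently Σ is biharmonic if and only if either H = 0, or the system |A|² − (4m − l²/2) − (l² − 4m)(c³)² = 0, (l² − 4m)c³a₁³ = 0, (l² − 4m)c³a₂³ = 0 holds, where A is the shape operator of Σ. -/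

import Mathlib

/-!
Coordinate-based Riemannian geometry on charts `ℝⁿ`, enough to express mean
curvature, second fundamental forms, curvature tensors and the (bi)tension
fields of isometric immersions, as used in
"Constant mean curvature and totally umbilical biharmonic surfaces in
3-dimensional geometries".
-/

noncomputable section

open scoped BigOperators

/-- A point of the coordinate chart `ℝⁿ`. -/
abbrev Pt (n : ℕ) := Fin n → ℝ

/-- A Riemannian metric on (an open part of) `ℝⁿ`, given by its coordinate matrix. -/
abbrev Met (n : ℕ) := Pt n → Matrix (Fin n) (Fin n) ℝ

/-- A vector field on `ℝⁿ`, in coordinates. -/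
abbrev VF (n : ℕ) := Pt n → Pt n

/-- The inner product of tangent vectors `v`, `w` at the point `p`, w.r.t. `g`. -/
def gip {n : ℕ} (g : Met n) (p v w : Pt n) : ℝ := ∑ i, ∑ j, g p i j * v i * w j

/-- `g` is a Riemannian metric: smooth, symmetric and positive definite. -/
structure IsRiemannian {n : ℕ} (g : Met n) : Prop where
  smooth : ∀ i j, ContDiff ℝ (⊤ : ℕ∞) fun p => g p i j
  symm : ∀ p i j, g p i j = g p j i
  posdef : ∀ p v, v ≠ 0 → 0 < gip g p v v

/-- Christoffel symbols `Γ^k_{ij}` of the Levi-Civita connection of `g`. -/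
def christoffel {n : ℕ} (g : Met n) (p : Pt n) (k i j : Fin n) : ℝ :=
  (1 / 2) * ∑ l, (g p)⁻¹ k l *
    (fderiv ℝ (fun q => g q j l) p (Pi.single i 1)
      + fderiv ℝ (fun q => g q i l) p (Pi.single j 1)
      - fderiv ℝ (fun q => g q i j) p (Pi.single l 1))

/-- The Levi-Civita covariant derivative `∇_X Y` of vector fields, in coordinates. -/
def cov {n : ℕ} (g : Met n) (X Y : VF n) : VF n := fun p k =>
  fderiv ℝ (fun q => Y q k) p (X p) + ∑ i, ∑ j, christoffel g p k i j * X p i * Y p j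

/-- The Lie bracket `[X, Y]` of vector fields. -/
def lieB {n : ℕ} (X Y : VF n) : VF n := fun p k =>
  fderiv ℝ (fun q => Y q k) p (X p) - fderiv ℝ (fun q => X q k) p (Y p)

/-- The curvature operator `R(X,Y)Z = ∇_X ∇_Y Z − ∇_Y ∇_X Z − ∇_{[X,Y]} Z`. -/
def curvOp {n : ℕ} (g : Met n) (X Y Z : VF n) : VF n := fun p =>
  cov g X (cov g Y Z) p - cov g Y (cov g X Z) p - cov g (lieB X Y) Z p

/-- The curvature tensor evaluated on tangent vectors at `p` (via constant extensions). -/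
def curvPt {n : ℕ} (g : Met n) (p v w z : Pt n) : Pt n :=
  curvOp g (fun _ => v) (fun _ => w) (fun _ => z) p

/-- The Ricci curvature `Ric(v, w) = trace (z ↦ R(z, v) w)` at `p`; for the Levi-Civita
connection of a Riemannian metric this agrees with `Σᵢ ⟨R(v, eᵢ) eᵢ, w⟩` for any
orthonormal frame `{eᵢ}`. -/
def ricci {n : ℕ} (g : Met n) (p v w : Pt n) : ℝ :=
  ∑ k, curvPt g p (Pi.single k 1) v w k

/-- The differential of `φ` at `u`, applied to the `a`-th coordinate direction. -/
def dmap {m n : ℕ} (φ : Pt m → Pt n) (u : Pt m) (a : Fin m) : Pt n := fun k =>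
  fderiv ℝ (fun q => φ q k) u (Pi.single a 1)

/-- The pushforward `dφ_u(v)` of a tangent vector of the domain. -/
def push {m n : ℕ} (φ : Pt m → Pt n) (u : Pt m) (v : Pt m) : Pt n := fun k =>
  fderiv ℝ (fun q => φ q k) u v

/-- The first fundamental form (induced metric) of the immersion `φ`. -/
def fff {m n : ℕ} (g : Met n) (φ : Pt m → Pt n) : Met m := fun u =>
  Matrix.of fun a b => gip g (φ u) (dmap φ u a) (dmap φ u b)

/-- `φ` is a smooth immersion. -/
def IsImmersion {m n : ℕ} (φ : Pt m → Pt n) : Prop :=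
  (∀ k, ContDiff ℝ (⊤ : ℕ∞) fun u => φ u k) ∧ ∀ u, LinearIndependent ℝ (dmap φ u)

/-- `ξ` is a (smooth) unit normal vector field along the immersion `φ`. -/
def IsUnitNormal {m n : ℕ} (g : Met n) (φ ξ : Pt m → Pt n) : Prop :=
  (∀ k, ContDiff ℝ (⊤ : ℕ∞) fun u => ξ u k) ∧ (∀ u, gip g (φ u) (ξ u) (ξ u) = 1) ∧
    ∀ u a, gip g (φ u) (ξ u) (dmap φ u a) = 0

/-- The second fundamental form `h_{ab} = ⟨∇^N_{∂_a} dφ(∂_b), ξ⟩` of `φ` w.r.t. `ξ`. -/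
def sff {m n : ℕ} (g : Met n) (φ ξ : Pt m → Pt n) (u : Pt m) (a b : Fin m) : ℝ :=
  gip g (φ u)
    (fun k => fderiv ℝ (fun q => dmap φ q b k) u (Pi.single a 1)
      + ∑ i, ∑ j, christoffel g (φ u) k i j * dmap φ u a i * dmap φ u b j)
    (ξ u)

/-- The shape operator `A^a_b = G^{ac} h_{cb}` of `φ` w.r.t. `ξ` (`G` the induced metric). -/
def shapeOp {m n : ℕ} (g : Met n) (φ ξ : Pt m → Pt n) (u : Pt m) (a b : Fin m) : ℝ :=
  ∑ c, (fff g φ u)⁻¹ a c * sff g φ ξ u c b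

/-- The mean curvature `H = (1/m) ⋅ trace A` of the hypersurface `φ` w.r.t. `ξ`. -/
def meanCurv {m n : ℕ} (g : Met n) (φ ξ : Pt m → Pt n) (u : Pt m) : ℝ :=
  (1 / (m : ℝ)) * ∑ a, shapeOp g φ ξ u a a

/-- The squared norm `|A|²` of the shape operator (= of the second fundamental form). -/
def normA2 {m n : ℕ} (g : Met n) (φ ξ : Pt m → Pt n) (u : Pt m) : ℝ :=
  ∑ a, ∑ b, shapeOp g φ ξ u a b * shapeOp g φ ξ u b a

/-- `φ` is totally umbilical w.r.t. `ξ`: at every point both principal curvatures are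
equal, i.e. the second fundamental form is a scalar multiple of the induced metric
(equivalently, the shape operator is a scalar multiple of the identity). -/
def IsTotallyUmbilical {m n : ℕ} (g : Met n) (φ ξ : Pt m → Pt n) : Prop :=
  ∃ lam : Pt m → ℝ, ∀ u a b, sff g φ ξ u a b = lam u * fff g φ u a b

/-- The tension field `τ(φ) = Trace_g ∇ dφ` of the isometric immersion `φ`
(the domain carrying the induced metric). -/
def tension {m n : ℕ} (g : Met n) (φ : Pt m → Pt n) (u : Pt m) : Pt n := fun k =>
  ∑ a, ∑ b, (fff g φ u)⁻¹ a b *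
    (fderiv ℝ (fun q => dmap φ q b k) u (Pi.single a 1)
      - ∑ c, christoffel (fff g φ) u c a b * dmap φ u c k
      + ∑ i, ∑ j, christoffel g (φ u) k i j * dmap φ u a i * dmap φ u b j)

/-- The pull-back covariant derivative `∇^φ_{∂_a} V` of a vector field `V` along `φ`. -/
def covAlong {m n : ℕ} (g : Met n) (φ : Pt m → Pt n) (V : Pt m → Pt n) (a : Fin m) :
    Pt m → Pt n := fun u k =>
  fderiv ℝ (fun q => V q k) u (Pi.single a 1)
    + ∑ i, ∑ j, christoffel g (φ u) k i j * dmap φ u a i * V u j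

/-- The bitension field
`τ₂(φ) = Trace_g (∇^φ ∇^φ − ∇^φ_{∇^M}) τ(φ) − Trace_g R^N(dφ, τ(φ)) dφ`. -/
def bitension {m n : ℕ} (g : Met n) (φ : Pt m → Pt n) (u : Pt m) : Pt n := fun k =>
  (∑ a, ∑ b, (fff g φ u)⁻¹ a b *
      (covAlong g φ (covAlong g φ (tension g φ) b) a u k
        - ∑ c, christoffel (fff g φ) u c a b * covAlong g φ (tension g φ) c u k))
    - ∑ a, ∑ b, (fff g φ u)⁻¹ a b *
        curvPt g (φ u) (dmap φ u a) (tension g φ u) (dmap φ u b) k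

/-- `φ` is a biharmonic isometric immersion: its bitension field vanishes.  (This is the
Euler–Lagrange characterisation of the critical points of the bienergy
`E²(φ,Ω) = (1/2)∫_Ω |τ(φ)|²` for every compact `Ω`.) -/
def IsBiharmonic {m n : ℕ} (g : Met n) (φ : Pt m → Pt n) : Prop := ∀ u, bitension g φ u = 0

/-- `φ` is minimal (equivalently, harmonic): its tension field vanishes, i.e. `H ≡ 0`. -/
def IsMinimal {m n : ℕ} (g : Met n) (φ : Pt m → Pt n) : Prop := ∀ u, tension g φ u = 0

/-- `φ` is proper biharmonic: biharmonic and not minimal. -/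
def IsProperBiharmonic {m n : ℕ} (g : Met n) (φ : Pt m → Pt n) : Prop :=
  IsBiharmonic g φ ∧ ¬IsMinimal g φ

/-! ### The Bianchi–Cartan–Vranceanu spaces `M³_{m,l}`, Sol, hyperbolic and flat space -/

/-- `F = 1 + m (x² + y²)`. -/
def bcvF (m : ℝ) (p : Pt 3) : ℝ := 1 + m * (p 0 ^ 2 + p 1 ^ 2)

/-- The coordinate covector of the one-form `dz + (l/2)(y dx − x dy)/F`. -/
def bcvω (m l : ℝ) (p : Pt 3) : Pt 3 :=
  ![l * p 1 / (2 * bcvF m p), -(l * p 0) / (2 * bcvF m p), 1]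

/-- The Bianchi–Cartan–Vranceanu metric
`g = (dx² + dy²)/(1 + m(x²+y²))² + (dz + (l/2)(y dx − x dy)/(1 + m(x²+y²)))²` on `ℝ³`. -/
def bcvMet (m l : ℝ) : Met 3 := fun p =>
  Matrix.of fun i j =>
    (if i = j ∧ (i : ℕ) < 2 then 1 / bcvF m p ^ 2 else 0) + bcvω m l p i * bcvω m l p j

/-- The frame `E₁ = F ∂_x − (l y/2) ∂_z`, `E₂ = F ∂_y + (l x/2) ∂_z`, `E₃ = ∂_z`
on the BCV space `M³_{m,l}`. -/
def bcvE (m l : ℝ) : Fin 3 → VF 3 :=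
  ![fun p => ![bcvF m p, 0, -(l * p 1) / 2],
    fun p => ![0, bcvF m p, l * p 0 / 2],
    fun _ => ![0, 0, 1]]

/-- The base metric `h = (dx² + dy²)/(1 + m(x²+y²))²` on `ℝ²` of the BCV Riemannian
submersion `π : M³_{m,l} → (ℝ², h)`, `π(x,y,z) = (x,y)`. -/
def bcvBase (m : ℝ) : Met 2 := fun p =>
  Matrix.of fun i j => if i = j then 1 / (1 + m * (p 0 ^ 2 + p 1 ^ 2)) ^ 2 else 0

/-- The geodesic curvature of a unit-speed curve `α` in `(ℝ², h)`, with respect to the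
unit normal obtained by rotating `α'` by `+π/2` (a Euclidean rotation, which is also an
`h`-rotation since `h` is conformal to the flat metric). -/
def geodCurv (m : ℝ) (α : ℝ → Pt 2) (s : ℝ) : ℝ :=
  gip (bcvBase m) (α s)
    (fun k => deriv (fun t => deriv α t k) s
      + ∑ i, ∑ j, christoffel (bcvBase m) (α s) k i j * deriv α s i * deriv α s j)
    ![-deriv α s 1, deriv α s 0]

/-- `φ` parametrises part of the Hopf cylinder `π⁻¹(α(I))` over a circle of radius
`1/√(8m − l²)` in the base sphere `S²(1/(2√m))`, identified with `(ℝ², h)`.  (In the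
base sphere, which has Gaussian curvature `4m` and extrinsic normal curvature `2√m`,
the circles of radius `1/√(8m − l²)` are exactly the curves of constant geodesic
curvature `κ₀` with `κ₀² = (8m − l²) − 4m = 4m − l²`.) -/
def PartOfHopfCylinderOverCircle (m l : ℝ) (φ : Pt 2 → Pt 3) : Prop :=
  ∃ α : ℝ → Pt 2, ContDiff ℝ (⊤ : ℕ∞) α ∧
    (∀ s, gip (bcvBase m) (α s) (deriv α s) (deriv α s) = 1) ∧
    (∃ κ₀ : ℝ, κ₀ ^ 2 = 4 * m - l ^ 2 ∧ ∀ s, geodCurv m α s = κ₀) ∧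
    ∀ u, ∃ s, φ u 0 = α s 0 ∧ φ u 1 = α s 1

/-- The Sol metric `g_{Sol} = e^{2z} dx² + e^{−2z} dy² + dz²` on `ℝ³`. -/
def solMet : Met 3 := fun p =>
  Matrix.of fun i j =>
    if i = j then
      if (i : ℕ) = 0 then Real.exp (2 * p 2)
      else if (i : ℕ) = 1 then Real.exp (-(2 * p 2)) else 1
    else 0

/-- The orthonormal frame `E₁ = e^{−z} ∂_x`, `E₂ = e^{z} ∂_y`, `E₃ = ∂_z` on Sol space. -/
def solE : Fin 3 → VF 3 :=
  ![fun p => ![Real.exp (-p 2), 0, 0],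
    fun p => ![0, Real.exp (p 2), 0],
    fun _ => ![0, 0, 1]]

/-- Hyperbolic 3-space `H³` in horospherical coordinates: `g = e^{2z}(dx² + dy²) + dz²`. -/
def hypMet : Met 3 := fun p =>
  Matrix.of fun i j => if i = j then (if (i : ℕ) < 2 then Real.exp (2 * p 2) else 1) else 0

/-- The flat metric on `ℝ³`. -/
def euclMet : Met 3 := fun _ => 1

noncomputable section
open scoped BigOperators

/-! ### general lemmas -/

lemma koszul {n : ℕ} (g : Met n) (p : Pt n) (hdet : IsUnit (g p).det) (r i j : Fin n) :
    ∑ k, g p r k * christoffel g p k i j =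
      (1 / 2) * (fderiv ℝ (fun q => g q j r) p (Pi.single i 1)
      + fderiv ℝ (fun q => g q i r) p (Pi.single j 1)
      - fderiv ℝ (fun q => g q i j) p (Pi.single r 1)) := by
  set K : Fin n → ℝ := fun l => (fderiv ℝ (fun q => g q j l) p (Pi.single i 1)
      + fderiv ℝ (fun q => g q i l) p (Pi.single j 1)
      - fderiv ℝ (fun q => g q i j) p (Pi.single l 1)) with hK
  have h1 : ∀ k, christoffel g p k i j = (1/2) * ((g p)⁻¹.mulVec K) k := fun k => rfl
  have h2 : (g p).mulVec ((g p)⁻¹.mulVec K) r = K r := by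
    rw [Matrix.mulVec_mulVec, Matrix.mul_nonsing_inv _ hdet, Matrix.one_mulVec]
  calc _ = (1/2) * (g p).mulVec ((g p)⁻¹.mulVec K) r := by
        simp only [h1, Matrix.mulVec, dotProduct, Finset.mul_sum]
        refine Finset.sum_congr rfl fun k _ => Finset.sum_congr rfl fun l _ => by ring
    _ = _ := by rw [h2]

lemma christoffel_symm {n : ℕ} (g : Met n) (hs : ∀ p i j, g p i j = g p j i) (p : Pt n)
    (k i j : Fin n) : christoffel g p k i j = christoffel g p k j i := by
  have : (fun q => g q i j) = (fun q => g q j i) := by ext q; exact hs q i j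
  simp only [christoffel, this]
  congr 1
  refine Finset.sum_congr rfl fun l _ => by ring

lemma metric_compat {n : ℕ} (g : Met n) (hs : ∀ p i j, g p i j = g p j i) (p : Pt n)
    (hdet : IsUnit (g p).det) (k i j : Fin n) :
    fderiv ℝ (fun q => g q i j) p (Pi.single k 1)
      = ∑ r, (g p j r * christoffel g p r k i + g p i r * christoffel g p r k j) := by
  rw [Finset.sum_add_distrib, koszul g p hdet, koszul g p hdet]
  have h : ∀ a b, (fun q => g q a b) = (fun q => g q b a) := by
    intro a b; ext q; exact hs q a b
  rw [h j i, h k j, h k i]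
  ring

lemma fderiv_single_sum {n : ℕ} (L : Pt n →L[ℝ] ℝ) (v : Pt n) :
    L v = ∑ i, v i * L (Pi.single i 1) := by
  conv_lhs => rw [pi_eq_sum_univ' v]
  simp [map_sum]

lemma dmap_eq {m n : ℕ} (φ : Pt m → Pt n) (u : Pt m) (a : Fin m)
    (h : ∀ k, DifferentiableAt ℝ (fun q => φ q k) u) :
    fderiv ℝ φ u (Pi.single a 1) = dmap φ u a := by
  ext k
  rw [dmap, fderiv_pi h]; rfl

/-- chain rule -/
lemma fderiv_comp_map {m n : ℕ} (φ : Pt m → Pt n) (u : Pt m) (f : Pt n → ℝ)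
    (h : ∀ k, DifferentiableAt ℝ (fun q => φ q k) u) (hf : DifferentiableAt ℝ f (φ u)) :
    DifferentiableAt ℝ (fun q => f (φ q)) u ∧
    ∀ a, fderiv ℝ (fun q => f (φ q)) u (Pi.single a 1) = fderiv ℝ f (φ u) (dmap φ u a) := by
  have hφ : DifferentiableAt ℝ φ u := differentiableAt_pi.2 h
  refine ⟨hf.comp u hφ, fun a => ?_⟩
  have := fderiv_comp u hf hφ
  change fderiv ℝ (f ∘ φ) u _ = _
  rw [this, ContinuousLinearMap.comp_apply, dmap_eq φ u a h]

lemma gip_add_left {n : ℕ} (g : Met n) (p v v' w : Pt n) :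
    gip g p (v + v') w = gip g p v w + gip g p v' w := by
  simp only [gip, ← Finset.sum_add_distrib, Pi.add_apply]
  refine Finset.sum_congr rfl fun i _ => Finset.sum_congr rfl fun j _ => by ring

lemma gip_smul_left {n : ℕ} (g : Met n) (p v w : Pt n) (c : ℝ) :
    gip g p (c • v) w = c * gip g p v w := by
  simp only [gip, Finset.mul_sum, Pi.smul_apply, smul_eq_mul]
  refine Finset.sum_congr rfl fun i _ => Finset.sum_congr rfl fun j _ => by ring

lemma gip_comm {n : ℕ} (g : Met n) (hs : ∀ p i j, g p i j = g p j i) (p v w : Pt n) :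
    gip g p v w = gip g p w v := by
  simp only [gip]
  rw [Finset.sum_comm]
  refine Finset.sum_congr rfl fun i _ => Finset.sum_congr rfl fun j _ => by
    rw [hs p j i]; ring

lemma gip_add_right {n : ℕ} (g : Met n) (p v w w' : Pt n) :
    gip g p v (w + w') = gip g p v w + gip g p v w' := by
  simp only [gip, ← Finset.sum_add_distrib, Pi.add_apply]
  refine Finset.sum_congr rfl fun i _ => Finset.sum_congr rfl fun j _ => by ring

lemma gip_smul_right {n : ℕ} (g : Met n) (p v w : Pt n) (c : ℝ) :
    gip g p v (c • w) = c * gip g p v w := by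
  simp only [gip, Finset.mul_sum, Pi.smul_apply, smul_eq_mul]
  refine Finset.sum_congr rfl fun i _ => Finset.sum_congr rfl fun j _ => by ring

lemma gip_compat {m n : ℕ} (g : Met n) (hs : ∀ p i j, g p i j = g p j i) (φ V W : Pt m → Pt n)
    (u : Pt m) (hdet : IsUnit (g (φ u)).det)
    (hg : ∀ i j, DifferentiableAt ℝ (fun q => g q i j) (φ u))
    (h : ∀ k, DifferentiableAt ℝ (fun q => φ q k) u)
    (hV : ∀ k, DifferentiableAt ℝ (fun q => V q k) u)
    (hW : ∀ k, DifferentiableAt ℝ (fun q => W q k) u) :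
    DifferentiableAt ℝ (fun q => gip g (φ q) (V q) (W q)) u ∧
    ∀ a, fderiv ℝ (fun q => gip g (φ q) (V q) (W q)) u (Pi.single a 1) =
      gip g (φ u) (covAlong g φ V a u) (W u) + gip g (φ u) (V u) (covAlong g φ W a u) := by
  have hc := fun i j => fderiv_comp_map φ u (fun q => g q i j) h (hg i j)
  have hd : HasFDerivAt (fun q => gip g (φ q) (V q) (W q))
      (∑ i, ∑ j, ((g (φ u) i j * V u i) • fderiv ℝ (fun q => W q j) u + 
        W u j • (g (φ u) i j • fderiv ℝ (fun q => V q i) u + V u i • fderiv ℝ (fun q => g (φ q) i j) u))) u := by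
    unfold gip
    refine HasFDerivAt.fun_sum fun i _ => HasFDerivAt.fun_sum fun j _ => ?_
    exact (((hc i j).1.hasFDerivAt.mul (hV i).hasFDerivAt)).mul (hW j).hasFDerivAt
  refine ⟨hd.differentiableAt, fun a => ?_⟩
  rw [hd.fderiv]
  have e : ∀ i j, fderiv ℝ (fun q => g (φ q) i j) u (Pi.single a 1) =
      ∑ k, ∑ r, dmap φ u a k * (g (φ u) j r * christoffel g (φ u) r k i
        + g (φ u) i r * christoffel g (φ u) r k j) := by
    intro i j
    rw [(hc i j).2 a, fderiv_single_sum]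
    refine Finset.sum_congr rfl fun k _ => ?_
    rw [metric_compat g hs _ hdet, Finset.mul_sum]
  simp only [_root_.sum_apply, _root_.add_apply, _root_.smul_apply, smul_eq_mul, e]
  have A1 : gip g (φ u) (covAlong g φ V a u) (W u) =
     (∑ i, ∑ j, g (φ u) i j * fderiv ℝ (fun q => V q i) u (Pi.single a 1) * W u j) +
     ∑ i, ∑ j, ∑ k, ∑ r, g (φ u) j r * christoffel g (φ u) r k i * dmap φ u a k * V u i * W u j := by
    simp only [gip, covAlong, mul_add, add_mul, Finset.sum_add_distrib]
    congr 1
    simp only [Finset.mul_sum, Finset.sum_mul]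
    -- LHS: r j k i
    have : ∀ r : Fin n, (∑ j, ∑ k, ∑ i, g (φ u) r j * (christoffel g (φ u) r k i * dmap φ u a k * V u i) * W u j)
       = ∑ i, ∑ j, ∑ k, g (φ u) j r * christoffel g (φ u) r k i * dmap φ u a k * V u i * W u j := by
      intro r
      rw [Finset.sum_comm_cycle]
      refine Finset.sum_congr rfl fun i _ => Finset.sum_congr rfl fun j _ => Finset.sum_congr rfl fun k _ => ?_
      rw [hs (φ u) r j]; ring
    simp only [this]
    rw [Finset.sum_comm]
    refine Finset.sum_congr rfl fun i _ => ?_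
    rw [Finset.sum_comm]
    refine Finset.sum_congr rfl fun j _ => ?_
    rw [Finset.sum_comm]
  have A2 : gip g (φ u) (V u) (covAlong g φ W a u) =
     (∑ i, ∑ j, g (φ u) i j * V u i * fderiv ℝ (fun q => W q j) u (Pi.single a 1)) +
     ∑ i, ∑ j, ∑ k, ∑ r, g (φ u) i r * christoffel g (φ u) r k j * dmap φ u a k * V u i * W u j := by
    simp only [gip, covAlong, mul_add, Finset.sum_add_distrib]
    congr 1
    simp only [Finset.mul_sum]
    refine Finset.sum_congr rfl fun i _ => ?_
    -- r k j
    rw [Finset.sum_comm_cycle]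
    refine Finset.sum_congr rfl fun j _ => ?_
    rw [Finset.sum_comm]
    refine Finset.sum_congr rfl fun k _ => Finset.sum_congr rfl fun r _ => by ring
  rw [A1, A2]
  simp only [← Finset.sum_add_distrib]
  have B : ∀ x y z w : ℝ, (x + y) + (z + w) = (z + x) + (y + w) := by intros; ring
  simp only [Finset.mul_sum, mul_add, Finset.sum_add_distrib, add_assoc, mul_assoc]
  simp only [mul_comm, mul_left_comm]
  ring

lemma two_le_top' : (2 : WithTop ℕ∞) ≤ ((⊤ : ℕ∞) : WithTop ℕ∞) :=
  WithTop.coe_le_coe.2 (le_top : (2 : ℕ∞) ≤ ⊤)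

lemma top_add_le' : (((⊤ : ℕ∞) : WithTop ℕ∞)) + 1 ≤ ((⊤ : ℕ∞) : WithTop ℕ∞) := le_rfl

lemma contDiff_partial {m : ℕ} (f : Pt m → ℝ) (hf : ContDiff ℝ (⊤ : ℕ∞) f) (v : Pt m) :
    ContDiff ℝ (⊤ : ℕ∞) (fun q => fderiv ℝ f q v) :=
  (hf.fderiv_right top_add_le').clm_apply contDiff_const

lemma smooth_diff {m : ℕ} {f : Pt m → ℝ} (hf : ContDiff ℝ (⊤ : ℕ∞) f) (u : Pt m) :
    DifferentiableAt ℝ f u := hf.differentiable (by simp) u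

lemma partial_symm {m : ℕ} (f : Pt m → ℝ) (hf : ContDiff ℝ (⊤ : ℕ∞) f) (u v w : Pt m) :
    fderiv ℝ (fun q => fderiv ℝ f q v) u w = fderiv ℝ (fun q => fderiv ℝ f q w) u v := by
  have hd : DifferentiableAt ℝ (fderiv ℝ f) u :=
    (hf.fderiv_right top_add_le').differentiable (by simp) u
  have h1 : ∀ v w, fderiv ℝ (fun q => fderiv ℝ f q v) u w = fderiv ℝ (fderiv ℝ f) u w v := by
    intro v w
    rw [fderiv_clm_apply hd (differentiableAt_const _)]
    simp
  rw [h1, h1]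
  have := (hf.contDiffAt (x := u)).isSymmSndFDerivAt
    (by rw [minSmoothness_of_isRCLikeNormedField]; exact two_le_top')
  exact this _ _

lemma torsion_free {m n : ℕ} (g : Met n) (hs : ∀ p i j, g p i j = g p j i) (φ : Pt m → Pt n)
    (hφ : ∀ k, ContDiff ℝ (⊤ : ℕ∞) fun u => φ u k) (u : Pt m) (a b : Fin m) :
    covAlong g φ (fun q => dmap φ q b) a u = covAlong g φ (fun q => dmap φ q a) b u := by
  ext k
  simp only [covAlong]
  congr 1
  · exact partial_symm _ (hφ k) _ _ _
  · rw [Finset.sum_comm]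
    refine Finset.sum_congr rfl fun i _ => Finset.sum_congr rfl fun j _ => ?_
    rw [christoffel_symm g hs]; ring

lemma cov_const {n : ℕ} (g : Met n) (v w : Pt n) :
    cov g (fun _ => v) (fun _ => w) = fun q k => ∑ i, ∑ j, christoffel g q k i j * v i * w j := by
  ext q k
  simp [cov]

lemma curvPt_eq {n : ℕ} (g : Met n) (p v w z : Pt n)
    (hΓ : ∀ k i j, DifferentiableAt ℝ (fun q => christoffel g q k i j) p) (k : Fin n) :
    curvPt g p v w z k =
      (∑ i, ∑ j, fderiv ℝ (fun q => christoffel g q k i j) p v * w i * z j)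
      + (∑ i, ∑ j, christoffel g p k i j * v i * ∑ a, ∑ b, christoffel g p j a b * w a * z b)
      - (∑ i, ∑ j, fderiv ℝ (fun q => christoffel g q k i j) p w * v i * z j)
      - (∑ i, ∑ j, christoffel g p k i j * w i * ∑ a, ∑ b, christoffel g p j a b * v a * z b) := by
  have hL : lieB (fun _ : Pt n => v) (fun _ => w) = fun _ => 0 := by
    ext q k; simp [lieB]
  have key : ∀ v w : Pt n, cov g (fun _ => v) (cov g (fun _ => w) (fun _ => z)) p k =
      (∑ i, ∑ j, fderiv ℝ (fun q => christoffel g q k i j) p v * w i * z j)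
      + (∑ i, ∑ j, christoffel g p k i j * v i * ∑ a, ∑ b, christoffel g p j a b * w a * z b) := by
    intro v w
    rw [cov_const]
    simp only [cov]
    congr 1
    have hd : HasFDerivAt (fun q => ∑ i, ∑ j, christoffel g q k i j * w i * z j)
        (∑ i, ∑ j, z j • (w i • fderiv ℝ (fun q => christoffel g q k i j) p)) p := by
      refine HasFDerivAt.fun_sum fun i _ => HasFDerivAt.fun_sum fun j _ => ?_
      exact ((hΓ k i j).hasFDerivAt.mul_const (w i)).mul_const (z j)
    rw [hd.fderiv]
    simp only [_root_.sum_apply, _root_.smul_apply, smul_eq_mul]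
    refine Finset.sum_congr rfl fun i _ => Finset.sum_congr rfl fun j _ => by ring
  simp only [curvPt, curvOp, Pi.sub_apply, key, hL]
  simp [cov]
  ring

lemma covAlong_diff {m n : ℕ} (g : Met n) (φ V : Pt m → Pt n) (u : Pt m)
    (hφ : ∀ k, ContDiff ℝ (⊤ : ℕ∞) fun u => φ u k)
    (hV : ∀ k, ContDiff ℝ (⊤ : ℕ∞) fun u => V u k)
    (hΓ : ∀ k i j, DifferentiableAt ℝ (fun q => christoffel g q k i j) (φ u)) (b : Fin m) (k : Fin n) :
    HasFDerivAt (fun q => covAlong g φ V b q k)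
     (fderiv ℝ (fun q => fderiv ℝ (fun q => V q k) q (Pi.single b 1)) u +
      ∑ i, ∑ j, ((christoffel g (φ u) k i j * dmap φ u b i) • fderiv ℝ (fun q => V q j) u +
        V u j • (christoffel g (φ u) k i j • fderiv ℝ (fun q => dmap φ q b i) u
          + dmap φ u b i • fderiv ℝ (fun q => christoffel g (φ q) k i j) u))) u := by
  have hc := fun i j => fderiv_comp_map φ u (fun q => christoffel g q k i j)
    (fun k => smooth_diff (hφ k) u) (hΓ k i j)
  unfold covAlong
  refine HasFDerivAt.add (smooth_diff (contDiff_partial _ (hV k) _) u).hasFDerivAt ?_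
  refine HasFDerivAt.fun_sum fun i _ => HasFDerivAt.fun_sum fun j _ => ?_
  exact ((hc i j).1.hasFDerivAt.mul
    (smooth_diff (contDiff_partial _ (hφ i) _) u).hasFDerivAt).mul (smooth_diff (hV j) u).hasFDerivAt

lemma ricci_identity {m n : ℕ} (g : Met n) (hs : ∀ p i j, g p i j = g p j i) (φ V : Pt m → Pt n) (u : Pt m)
    (hφ : ∀ k, ContDiff ℝ (⊤ : ℕ∞) fun u => φ u k)
    (hV : ∀ k, ContDiff ℝ (⊤ : ℕ∞) fun u => V u k)
    (hΓ : ∀ k i j, DifferentiableAt ℝ (fun q => christoffel g q k i j) (φ u)) (a b : Fin m) :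
    covAlong g φ (covAlong g φ V b) a u - covAlong g φ (covAlong g φ V a) b u
      = curvPt g (φ u) (dmap φ u a) (dmap φ u b) (V u) := by
  ext k
  rw [curvPt_eq g _ _ _ _ hΓ]
  have hc := fun i j => fderiv_comp_map φ u (fun q => christoffel g q k i j)
    (fun k => smooth_diff (hφ k) u) (hΓ k i j)
  have key : ∀ a b, covAlong g φ (covAlong g φ V b) a u k =
      fderiv ℝ (fun q => fderiv ℝ (fun q => V q k) q (Pi.single b 1)) u (Pi.single a 1)
      + (∑ i, ∑ j, christoffel g (φ u) k i j * dmap φ u b i * fderiv ℝ (fun q => V q j) u (Pi.single a 1))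
      + (∑ i, ∑ j, christoffel g (φ u) k i j * fderiv ℝ (fun q => dmap φ q b i) u (Pi.single a 1) * V u j)
      + (∑ i, ∑ j, fderiv ℝ (fun q => christoffel g q k i j) (φ u) (dmap φ u a) * dmap φ u b i * V u j)
      + (∑ i, ∑ j, christoffel g (φ u) k i j * dmap φ u a i * fderiv ℝ (fun q => V q j) u (Pi.single b 1))
      + (∑ i, ∑ j, christoffel g (φ u) k i j * dmap φ u a i *
          ∑ c, ∑ d, christoffel g (φ u) j c d * dmap φ u b c * V u d) := by
    intro a b
    change fderiv ℝ (fun q => covAlong g φ V b q k) u (Pi.single a 1) +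
      ∑ i, ∑ j, christoffel g (φ u) k i j * dmap φ u a i * (covAlong g φ V b u j) = _
    rw [(covAlong_diff g φ V u hφ hV hΓ b k).fderiv]
    simp only [_root_.sum_apply, _root_.add_apply, _root_.smul_apply, smul_eq_mul, (hc _ _).2]
    simp only [covAlong, mul_add, Finset.sum_add_distrib, add_assoc]
    have e1 : ∀ x y z : ℝ, x * (y * z) = y * z * x := by intros; ring
    simp only [e1 (V u _)]
    simp only [mul_comm (dmap φ u b _) (fderiv ℝ _ _ _)]
  rw [Pi.sub_apply, key, key]
  rw [partial_symm _ (hV k) u (Pi.single b 1) (Pi.single a 1)]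
  have : ∀ i, fderiv ℝ (fun q => dmap φ q b i) u (Pi.single a 1) =
    fderiv ℝ (fun q => dmap φ q a i) u (Pi.single b 1) := fun i => partial_symm _ (hφ i) _ _ _
  simp only [this]
  ring

end

noncomputable section
open scoped BigOperators

/-! ### BCV -/

lemma bcv_symm (m l : ℝ) (p : Pt 3) (i j : Fin 3) : bcvMet m l p i j = bcvMet m l p j i := by
  simp only [bcvMet, Matrix.of_apply]
  rw [mul_comm]
  congr 1
  by_cases h : i = j
  · subst h; rfl
  · simp [h, Ne.symm h]

/-- inverse of F -/
def bcvU (m : ℝ) (p : Pt 3) : ℝ := (bcvF m p)⁻¹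

def gx (m l : ℝ) (p : Pt 3) : Fin 3 → Fin 3 → ℝ :=
  ![![bcvU m p ^ 2 * (1 + l^2 * p 1 ^ 2 / 4), -(l^2 * p 0 * p 1 * bcvU m p ^ 2 / 4), l * p 1 * bcvU m p / 2],
    ![-(l^2 * p 0 * p 1 * bcvU m p ^ 2 / 4), bcvU m p ^ 2 * (1 + l^2 * p 0 ^ 2 / 4), -(l * p 0 * bcvU m p / 2)],
    ![l * p 1 * bcvU m p / 2, -(l * p 0 * bcvU m p / 2), 1]]

def gi (m l : ℝ) (p : Pt 3) : Matrix (Fin 3) (Fin 3) ℝ :=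
  !![bcvF m p ^ 2, 0, -(l * p 1 * bcvF m p / 2);
    0, bcvF m p ^ 2, l * p 0 * bcvF m p / 2;
    -(l * p 1 * bcvF m p / 2), l * p 0 * bcvF m p / 2, 1 + l^2 * (p 0 ^ 2 + p 1 ^ 2) / 4]

lemma bcv_eq_gx (m l : ℝ) (p : Pt 3) (i j : Fin 3) : bcvMet m l p i j = gx m l p i j := by
  fin_cases i <;> fin_cases j <;> simp [bcvMet, bcvω, gx, bcvU] <;> ring

lemma bcv_mul_gi (m l : ℝ) (p : Pt 3) (hF : bcvF m p ≠ 0) : bcvMet m l p * gi m l p = 1 := by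
  ext i j
  have : bcvU m p = (bcvF m p)⁻¹ := rfl
  rw [Matrix.mul_apply, Fin.sum_univ_three]
  simp only [bcv_eq_gx]
  fin_cases i <;> fin_cases j <;> simp [gi, gx, this] <;> field_simp <;> ring

lemma bcv_inv (m l : ℝ) (p : Pt 3) (hF : bcvF m p ≠ 0) : (bcvMet m l p)⁻¹ = gi m l p :=
  Matrix.inv_eq_right_inv (bcv_mul_gi m l p hF)

lemma bcv_det (m l : ℝ) (p : Pt 3) (hF : bcvF m p ≠ 0) : IsUnit (bcvMet m l p).det :=
  Matrix.isUnit_det_of_right_inverse (bcv_mul_gi m l p hF)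

lemma bcvF_diff (m : ℝ) (p : Pt 3) : DifferentiableAt ℝ (bcvF m) p := by
  unfold bcvF; fun_prop

lemma bcvU_diff (m : ℝ) (p : Pt 3) (hF : bcvF m p ≠ 0) : DifferentiableAt ℝ (bcvU m) p := 
  (bcvF_diff m p).inv hF

lemma fderiv_coord (p v : Pt 3) (i : Fin 3) : fderiv ℝ (fun q : Pt 3 => q i) p v = v i := by
  have : HasFDerivAt (fun q : Pt 3 => q i) (ContinuousLinearMap.proj (R := ℝ) (φ := fun _ : Fin 3 => ℝ) i) p :=
    hasFDerivAt_apply i p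
  rw [this.fderiv]; rfl

lemma bcvU_fderiv (m : ℝ) (p : Pt 3) (hF : bcvF m p ≠ 0) (v : Pt 3) :
    fderiv ℝ (fun q => bcvU m q) p v = -(bcvU m p ^ 2 * (2 * m * (p 0 * v 0 + p 1 * v 1))) := by
  have h : HasFDerivAt (fun q => bcvU m q) _ p := (hasDerivAt_inv hF).comp_hasFDerivAt p (bcvF_diff m p).hasFDerivAt
  rw [h.fderiv]
  have h0 : HasFDerivAt (fun q : Pt 3 => q 0) (ContinuousLinearMap.proj (R := ℝ) (φ := fun _ : Fin 3 => ℝ) 0) p :=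
    hasFDerivAt_apply 0 p
  have h1 : HasFDerivAt (fun q : Pt 3 => q 1) (ContinuousLinearMap.proj (R := ℝ) (φ := fun _ : Fin 3 => ℝ) 1) p :=
    hasFDerivAt_apply 1 p
  have h2 : HasFDerivAt (bcvF m) _ p := (((h0.pow 2).add (h1.pow 2)).const_mul m).const_add 1
  rw [h2.fderiv]
  simp [bcvU]
  ring

lemma gx_fderiv (m l : ℝ) (p v : Pt 3) (hF : bcvF m p ≠ 0) (i j : Fin 3) :
    fderiv ℝ (fun q => bcvMet m l q i j) p v =
      (![![2 * bcvU m p * (-(bcvU m p ^ 2 * (2 * m * (p 0 * v 0 + p 1 * v 1)))) * (1 + l^2 * p 1 ^ 2 / 4)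
          + bcvU m p ^ 2 * (l^2 * p 1 * v 1 / 2), 
          -(l^2 * (v 0 * p 1 + p 0 * v 1) * bcvU m p ^ 2 / 4) - (l^2 * p 0 * p 1 * bcvU m p * (-(bcvU m p ^ 2 * (2 * m * (p 0 * v 0 + p 1 * v 1)))) / 2), 
          l * v 1 * bcvU m p / 2 + l * p 1 * (-(bcvU m p ^ 2 * (2 * m * (p 0 * v 0 + p 1 * v 1)))) / 2],
    ![-(l^2 * (v 0 * p 1 + p 0 * v 1) * bcvU m p ^ 2 / 4) - (l^2 * p 0 * p 1 * bcvU m p * (-(bcvU m p ^ 2 * (2 * m * (p 0 * v 0 + p 1 * v 1)))) / 2),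
     2 * bcvU m p * (-(bcvU m p ^ 2 * (2 * m * (p 0 * v 0 + p 1 * v 1)))) * (1 + l^2 * p 0 ^ 2 / 4)
          + bcvU m p ^ 2 * (l^2 * p 0 * v 0 / 2), 
     -(l * v 0 * bcvU m p / 2 + l * p 0 * (-(bcvU m p ^ 2 * (2 * m * (p 0 * v 0 + p 1 * v 1)))) / 2)],
    ![l * v 1 * bcvU m p / 2 + l * p 1 * (-(bcvU m p ^ 2 * (2 * m * (p 0 * v 0 + p 1 * v 1)))) / 2,
     -(l * v 0 * bcvU m p / 2 + l * p 0 * (-(bcvU m p ^ 2 * (2 * m * (p 0 * v 0 + p 1 * v 1)))) / 2), 0]] : Fin 3 → Fin 3 → ℝ) i j := by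
  have hU : DifferentiableAt ℝ (fun q => bcvU m q) p := bcvU_diff m p hF
  simp only [bcv_eq_gx]
  fin_cases i <;> fin_cases j <;> simp [gx] <;> 
    simp (disch := fun_prop) [fderiv_fun_mul, fderiv_fun_pow, fderiv_coord, bcvU_fderiv m p hF, div_eq_mul_inv] <;> ring

end

noncomputable section
open scoped BigOperators

/-- explicit Christoffel symbols of the BCV metric -/
def bG (m l x y U : ℝ) : Fin 3 → Fin 3 → Fin 3 → ℝ :=
  ![![![-(2*m*x*U), (l^2/4 - 2*m)*y*U, 0],
      ![(l^2/4 - 2*m)*y*U, (2*m - l^2/2)*x*U, l/2],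
      ![0, l/2, 0]],
    ![![(2*m - l^2/2)*y*U, (l^2/4 - 2*m)*x*U, -(l/2)],
      ![(l^2/4 - 2*m)*x*U, -(2*m*y*U), 0],
      ![-(l/2), 0, 0]],
    ![![(l*m - l^3/4)*x*y*U^2, (l^3/8 - l*m/2)*(x^2-y^2)*U^2, -(l^2/4*x*U)],
      ![(l^3/8 - l*m/2)*(x^2-y^2)*U^2, (l^3/4 - l*m)*x*y*U^2, -(l^2/4*y*U)],
      ![-(l^2/4*x*U), -(l^2/4*y*U), 0]]]

/-- explicit derivatives of the Christoffel symbols -/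
def bG' (m l x y U x' y' U' : ℝ) : Fin 3 → Fin 3 → Fin 3 → ℝ :=
  ![![![-(2*m*(x'*U+x*U')), (l^2/4 - 2*m)*(y'*U+y*U'), 0],
      ![(l^2/4 - 2*m)*(y'*U+y*U'), (2*m - l^2/2)*(x'*U+x*U'), 0],
      ![0, 0, 0]],
    ![![(2*m - l^2/2)*(y'*U+y*U'), (l^2/4 - 2*m)*(x'*U+x*U'), 0],
      ![(l^2/4 - 2*m)*(x'*U+x*U'), -(2*m*(y'*U+y*U')), 0],
      ![0, 0, 0]],
    ![![(l*m - l^3/4)*(x'*y*U^2+x*y'*U^2+2*x*y*U*U'), (l^3/8 - l*m/2)*((2*x*x'-2*y*y')*U^2+(x^2-y^2)*(2*U*U')), -(l^2/4*(x'*U+x*U'))],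
      ![(l^3/8 - l*m/2)*((2*x*x'-2*y*y')*U^2+(x^2-y^2)*(2*U*U')), (l^3/4 - l*m)*(x'*y*U^2+x*y'*U^2+2*x*y*U*U'), -(l^2/4*(y'*U+y*U'))],
      ![-(l^2/4*(x'*U+x*U')), -(l^2/4*(y'*U+y*U')), 0]]]

set_option maxHeartbeats 1600000 in
lemma bcv_christoffel (m l : ℝ) (p : Pt 3) (hF : bcvF m p ≠ 0) (k i j : Fin 3) :
    christoffel (bcvMet m l) p k i j = bG m l (p 0) (p 1) (bcvU m p) k i j := by
  have hU : bcvU m p * bcvF m p = 1 := inv_mul_cancel₀ hF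
  have hE : bcvF m p = 1 + m * (p 0 ^ 2 + p 1 ^ 2) := rfl
  have hFU : bcvF m p = (bcvU m p)⁻¹ := (inv_inv _).symm
  have hU0 : bcvU m p ≠ 0 := inv_ne_zero hF
  have hm : m * (p 0 ^ 2 + p 1 ^ 2) = (bcvU m p)⁻¹ - 1 := by rw [← hFU, hE]; ring
  simp only [christoffel, bcv_inv m l p hF, Fin.sum_univ_three, gx_fderiv m l p _ hF]
  generalize bcvU m p = U at *
  rw [hE] at hU
  simp only [gi, hE]
  clear hFU hm hE hF
  generalize p 0 = x at *
  generalize p 1 = y at *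
  fin_cases k <;> fin_cases i <;> fin_cases j <;> simp [bG]
  all_goals
    have hD : 1 + m * (x ^ 2 + y ^ 2) ≠ 0 := right_ne_zero_of_mul_eq_one hU
    have hUe : U = (1 + m * (x ^ 2 + y ^ 2))⁻¹ := eq_inv_of_mul_eq_one_left hU
    clear hU hU0
    subst hUe
    try field_simp
    try ring
end

noncomputable section
open scoped BigOperators

lemma bcv_near (m : ℝ) (p : Pt 3) (hF : bcvF m p ≠ 0) : ∀ᶠ q in nhds p, bcvF m q ≠ 0 := by
  have hc : ContinuousAt (bcvF m) p := (bcvF_diff m p).continuousAt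
  exact hc.eventually_ne hF

lemma bG_deriv (m l : ℝ) (p : Pt 3) (hF : bcvF m p ≠ 0) (k i j : Fin 3) :
    DifferentiableAt ℝ (fun q => bG m l (q 0) (q 1) (bcvU m q) k i j) p ∧
    ∀ v, fderiv ℝ (fun q => bG m l (q 0) (q 1) (bcvU m q) k i j) p v = 
      bG' m l (p 0) (p 1) (bcvU m p) (v 0) (v 1)
        (-(bcvU m p ^ 2 * (2 * m * (p 0 * v 0 + p 1 * v 1)))) k i j := by
  have hU : DifferentiableAt ℝ (fun q => bcvU m q) p := bcvU_diff m p hF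
  constructor
  · fin_cases k <;> fin_cases i <;> fin_cases j <;> simp [bG] <;> fun_prop
  · intro v
    rw [← bcvU_fderiv m p hF]
    fin_cases k <;> fin_cases i <;> fin_cases j <;> simp [bG, bG'] <;>
    simp (disch := fun_prop) [fderiv_fun_mul, fderiv_fun_pow, fderiv_fun_sub, fderiv_coord] <;> ring

lemma bcv_christoffel_deriv (m l : ℝ) (p : Pt 3) (hF : bcvF m p ≠ 0) (k i j : Fin 3) :
    DifferentiableAt ℝ (fun q => christoffel (bcvMet m l) q k i j) p ∧
    ∀ v, fderiv ℝ (fun q => christoffel (bcvMet m l) q k i j) p v = 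
      bG' m l (p 0) (p 1) (bcvU m p) (v 0) (v 1)
        (-(bcvU m p ^ 2 * (2 * m * (p 0 * v 0 + p 1 * v 1)))) k i j := by
  have he : (fun q => christoffel (bcvMet m l) q k i j) =ᶠ[nhds p]
      (fun q => bG m l (q 0) (q 1) (bcvU m q) k i j) := by
    filter_upwards [bcv_near m p hF] with q hq
    exact bcv_christoffel m l q hq k i j
  obtain ⟨h1, h2⟩ := bG_deriv m l p hF k i j
  refine ⟨h1.congr_of_eventuallyEq he, fun v => ?_⟩
  rw [he.fderiv_eq, h2]

/-- frame components -/
def th (m l : ℝ) (p v : Pt 3) : Fin 3 → ℝ :=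
  ![v 0 * bcvU m p, v 1 * bcvU m p, (l * p 1 * v 0 - l * p 0 * v 1) * bcvU m p / 2 + v 2]

lemma gip_th (m l : ℝ) (p v w : Pt 3) : gip (bcvMet m l) p v w =
    th m l p v 0 * th m l p w 0 + th m l p v 1 * th m l p w 1 + th m l p v 2 * th m l p w 2 := by
  simp [gip, Fin.sum_univ_three, bcv_eq_gx, gx, th]
  ring

/-- coordinates from frame components -/
def unth (m l : ℝ) (p : Pt 3) (a : Fin 3 → ℝ) : Pt 3 :=
  ![bcvF m p * a 0, bcvF m p * a 1, -(l * p 1) / 2 * a 0 + l * p 0 / 2 * a 1 + a 2]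

lemma th_unth (m l : ℝ) (p : Pt 3) (hF : bcvF m p ≠ 0) (a : Fin 3 → ℝ) :
    th m l p (unth m l p a) = a := by
  ext i
  fin_cases i <;> simp [th, unth, bcvU] <;> field_simp <;> ring

lemma unth_th (m l : ℝ) (p : Pt 3) (hF : bcvF m p ≠ 0) (v : Pt 3) :
    unth m l p (th m l p v) = v := by
  ext i
  fin_cases i <;> simp [th, unth, bcvU] <;> field_simp <;> ring

lemma bcvE_unth (m l : ℝ) (p : Pt 3) (a : Fin 3 → ℝ) :
    ∑ γ, a γ • bcvE m l γ p = unth m l p a := by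
  ext i
  fin_cases i <;> simp [Fin.sum_univ_three, bcvE, unth] <;> ring

/-- curvature, in frame components: `z × Q (x × y)`. -/
def Rf (m l : ℝ) (x y z : Fin 3 → ℝ) : Fin 3 → ℝ :=
  ![z 1 * ((4*m - 3*l^2/4) * (x 0 * y 1 - x 1 * y 0)) - z 2 * (l^2/4 * (x 2 * y 0 - x 0 * y 2)),
    z 2 * (l^2/4 * (x 1 * y 2 - x 2 * y 1)) - z 0 * ((4*m - 3*l^2/4) * (x 0 * y 1 - x 1 * y 0)),
    z 0 * (l^2/4 * (x 2 * y 0 - x 0 * y 2)) - z 1 * (l^2/4 * (x 1 * y 2 - x 2 * y 1))]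

set_option maxHeartbeats 4000000 in
lemma bcv_curv (m l : ℝ) (p : Pt 3) (hF : bcvF m p ≠ 0) (v w z : Pt 3) :
    curvPt (bcvMet m l) p v w z =
      unth m l p (Rf m l (th m l p v) (th m l p w) (th m l p z)) := by
  have hU : bcvU m p * bcvF m p = 1 := inv_mul_cancel₀ hF
  have hE : bcvF m p = 1 + m * (p 0 ^ 2 + p 1 ^ 2) := rfl
  ext k
  rw [curvPt_eq _ _ _ _ _ (fun k i j => (bcv_christoffel_deriv m l p hF k i j).1)]
  simp only [(bcv_christoffel_deriv m l p hF _ _ _).2, bcv_christoffel m l p hF, Fin.sum_univ_three]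
  simp only [unth, Rf, th]
  rw [hE] at hU
  simp only [hE]
  clear hE hF
  generalize bcvU m p = U at *
  generalize p 0 = x at *
  generalize p 1 = y at *
  generalize v 0 = v0 at *
  generalize v 1 = v1 at *
  generalize v 2 = v2 at *
  generalize w 0 = w0 at *
  generalize w 1 = w1 at *
  generalize w 2 = w2 at *
  generalize z 0 = z0 at *
  generalize z 1 = z1 at *
  generalize z 2 = z2 at *
  have hD : 1 + m * (x ^ 2 + y ^ 2) ≠ 0 := right_ne_zero_of_mul_eq_one hU
  have hUe : U = (1 + m * (x ^ 2 + y ^ 2))⁻¹ := eq_inv_of_mul_eq_one_left hU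
  clear hU
  subst hUe
  fin_cases k <;> simp [bG, bG'] <;> field_simp <;> ring
end

noncomputable section
open scoped BigOperators

lemma th_add (m l : ℝ) (p v w : Pt 3) (i : Fin 3) :
    th m l p (v + w) i = th m l p v i + th m l p w i := by
  fin_cases i <;> simp [th] <;> ring

lemma th_smul (m l : ℝ) (p v : Pt 3) (c : ℝ) (i : Fin 3) :
    th m l p (c • v) i = c * th m l p v i := by
  fin_cases i <;> simp [th] <;> ring

lemma gip_sub_left {n : ℕ} (g : Met n) (p v v' w : Pt n) :
    gip g p (v - v') w = gip g p v w - gip g p v' w := by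
  have := gip_add_left g p (v - v') v' w
  rw [sub_add_cancel] at this
  linarith

lemma gip_zero_left {n : ℕ} (g : Met n) (p w : Pt n) : gip g p 0 w = 0 := by
  simp [gip]

lemma gip_sum_left {n : ℕ} {ι : Type*} (s : Finset ι) (g : Met n) (p w : Pt n) (v : ι → Pt n) :
    gip g p (∑ i ∈ s, v i) w = ∑ i ∈ s, gip g p (v i) w := by
  classical
  induction s using Finset.induction_on with
  | empty => simp [gip_zero_left]
  | insert a s ha ih => rw [Finset.sum_insert ha, Finset.sum_insert ha, gip_add_left, ih]

lemma bcv_pos (m l : ℝ) (p v : Pt 3) (hF : bcvF m p ≠ 0) (h : gip (bcvMet m l) p v v = 0) :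
    v = 0 := by
  rw [gip_th] at h
  have h0 : th m l p v 0 = 0 := by nlinarith [sq_nonneg (th m l p v 0), sq_nonneg (th m l p v 1), sq_nonneg (th m l p v 2)]
  have h1 : th m l p v 1 = 0 := by nlinarith [sq_nonneg (th m l p v 0), sq_nonneg (th m l p v 1), sq_nonneg (th m l p v 2)]
  have h2 : th m l p v 2 = 0 := by nlinarith [sq_nonneg (th m l p v 0), sq_nonneg (th m l p v 1), sq_nonneg (th m l p v 2)]
  rw [← unth_th m l p hF v]
  ext i
  fin_cases i <;> simp [unth, h0, h1, h2]

lemma bcv_ndeg (m l : ℝ) (p v : Pt 3) (hF : bcvF m p ≠ 0) (b : Fin 3 → Pt 3)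
    (hb : LinearIndependent ℝ b) (h : ∀ i, gip (bcvMet m l) p v (b i) = 0) : v = 0 := by
  apply bcv_pos m l p v hF
  have hs : Submodule.span ℝ (Set.range b) = ⊤ :=
    hb.span_eq_top_of_card_eq_finrank (by simp)
  have hv : v ∈ Submodule.span ℝ (Set.range b) := by rw [hs]; trivial
  have : ∀ x ∈ Submodule.span ℝ (Set.range b), gip (bcvMet m l) p v x = 0 := by
    intro x hx
    induction hx using Submodule.span_induction with
    | mem x hx => obtain ⟨i, rfl⟩ := hx; exact h i
    | zero => rw [gip_comm _ (bcv_symm m l), gip_zero_left]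
    | add x y _ _ hx hy => rw [gip_add_right, hx, hy, add_zero]
    | smul c x _ hx => rw [gip_smul_right, hx, mul_zero]
  exact this v hv

lemma bcv_ricci (m l : ℝ) (p : Pt 3) (hF : bcvF m p ≠ 0) (v w : Pt 3) :
    ricci (bcvMet m l) p v w = (4 * m - l ^ 2 / 2) *
      (th m l p v 0 * th m l p w 0 + th m l p v 1 * th m l p w 1)
      + l ^ 2 / 2 * (th m l p v 2 * th m l p w 2) := by
  have hU : bcvF m p * bcvU m p = 1 := mul_inv_cancel₀ hF
  simp only [ricci, bcv_curv m l p hF, Fin.sum_univ_three]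
  generalize th m l p v = v
  generalize th m l p w = w
  simp [unth, Rf, th]
  field_simp
  linear_combination (32 * m * (v 0 * w 0 + v 1 * w 1) - 6 * l ^ 2 * (v 0 * w 0 + v 1 * w 1)
    + 4 * l ^ 2 * v 2 * w 2 + l ^ 3 * w 2 * (v 1 * p 0 - v 0 * p 1)) * hU

/-- data for the surface -/
structure Setup (m l : ℝ) (φ ξ : Pt 2 → Pt 3) : Prop where
  imm : IsImmersion φ
  dom : ∀ u, bcvF m (φ u) ≠ 0
  nor : IsUnitNormal (bcvMet m l) φ ξ

variable {m l : ℝ} {φ ξ : Pt 2 → Pt 3}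

lemma Setup.basis (S : Setup m l φ ξ) (u : Pt 2) :
    LinearIndependent ℝ ![dmap φ u 0, dmap φ u 1, ξ u] := by
  rw [Fintype.linearIndependent_iff]
  intro c hc
  simp only [Fin.sum_univ_three] at hc
  simp at hc
  have h2 : c 2 = 0 := by
    have := gip_zero_left (bcvMet m l) (φ u) (ξ u)
    rw [← hc, gip_add_left, gip_add_left, gip_smul_left, gip_smul_left, gip_smul_left,
      S.nor.2.1, gip_comm _ (bcv_symm m l), S.nor.2.2, gip_comm _ (bcv_symm m l), S.nor.2.2] at this
    linarith
  have hl := Fintype.linearIndependent_iff.1 (S.imm.2 u) ![c 0, c 1] (by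
    rw [h2, zero_smul, add_zero] at hc
    simpa [Fin.sum_univ_two] using hc)
  have h0 := hl 0
  have h1 := hl 1
  simp at h0 h1
  intro i
  fin_cases i <;> simp [h0, h1, h2]

lemma Setup.ext (S : Setup m l φ ξ) (u : Pt 2) (v w : Pt 3)
    (h0 : ∀ a, gip (bcvMet m l) (φ u) v (dmap φ u a) = gip (bcvMet m l) (φ u) w (dmap φ u a))
    (h2 : gip (bcvMet m l) (φ u) v (ξ u) = gip (bcvMet m l) (φ u) w (ξ u)) : v = w := by
  rw [← sub_eq_zero]
  refine bcv_ndeg m l (φ u) _ (S.dom u) _ (S.basis u) fun i => ?_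
  fin_cases i <;> simp [gip_sub_left, h0, h2]

lemma fff_def (g : Met 3) (u : Pt 2) (a b : Fin 2) :
    fff g φ u a b = gip g (φ u) (dmap φ u a) (dmap φ u b) := rfl

lemma fff_symm (m l : ℝ) (φ : Pt 2 → Pt 3) (u : Pt 2) (a b : Fin 2) :
    fff (bcvMet m l) φ u a b = fff (bcvMet m l) φ u b a := by
  rw [fff_def, gip_comm _ (bcv_symm m l)]; rfl

lemma Setup.det_ne (S : Setup m l φ ξ) (u : Pt 2) :
    fff (bcvMet m l) φ u 0 0 * fff (bcvMet m l) φ u 1 1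
      - fff (bcvMet m l) φ u 0 1 ^ 2 ≠ 0 := by
  intro h
  have hli := Fintype.linearIndependent_iff.1 (S.imm.2 u)
  set G := fff (bcvMet m l) φ u with hG
  have hw : gip (bcvMet m l) (φ u) (G 1 1 • dmap φ u 0 + (-G 0 1) • dmap φ u 1)
      (G 1 1 • dmap φ u 0 + (-G 0 1) • dmap φ u 1) = 0 := by
    simp only [gip_add_left, gip_smul_left, gip_add_right, gip_smul_right, ← fff_def, ← hG]
    rw [show G 1 0 = G 0 1 from fff_symm _ _ _ _ _ _]
    linear_combination G 1 1 * h
  have h0 := bcv_pos m l _ _ (S.dom u) hw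
  have h1 := hli ![G 1 1, -G 0 1] (by simpa [Fin.sum_univ_two] using h0) 0
  simp at h1
  have h2 : dmap φ u 1 = 0 := bcv_pos m l _ _ (S.dom u) h1
  have h3 := hli ![0, 1] (by simp [Fin.sum_univ_two, h2]) 1
  simp at h3

lemma Setup.det_unit (S : Setup m l φ ξ) (u : Pt 2) :
    IsUnit (fff (bcvMet m l) φ u).det := by
  rw [Matrix.det_fin_two, isUnit_iff_ne_zero, fff_symm m l φ u 1 0]
  have := S.det_ne u
  rwa [sq] at this

/-- the frame vector field along φ -/
def fr (φ : Pt 2 → Pt 3) (a : Fin 2) : Pt 2 → Pt 3 := fun q => dmap φ q a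

lemma Setup.fr_smooth (S : Setup m l φ ξ) (a : Fin 2) (k : Fin 3) :
    ContDiff ℝ (⊤ : ℕ∞) (fun q => fr φ a q k) := contDiff_partial _ (S.imm.1 k) _

lemma Setup.hΓ (S : Setup m l φ ξ) (u : Pt 2) (k i j : Fin 3) :
    DifferentiableAt ℝ (fun q => christoffel (bcvMet m l) q k i j) (φ u) :=
  (bcv_christoffel_deriv m l (φ u) (S.dom u) k i j).1

lemma bcv_diff (m l : ℝ) (p : Pt 3) (hF : bcvF m p ≠ 0) (i j : Fin 3) :
    DifferentiableAt ℝ (fun q => bcvMet m l q i j) p := by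
  have hU : DifferentiableAt ℝ (fun q => bcvU m q) p := bcvU_diff m p hF
  simp only [bcv_eq_gx]
  fin_cases i <;> fin_cases j <;> simp [gx] <;> fun_prop

lemma Setup.compat (S : Setup m l φ ξ) (u : Pt 2) (V W : Pt 2 → Pt 3)
    (hV : ∀ k, DifferentiableAt ℝ (fun q => V q k) u)
    (hW : ∀ k, DifferentiableAt ℝ (fun q => W q k) u) :
    DifferentiableAt ℝ (fun q => gip (bcvMet m l) (φ q) (V q) (W q)) u ∧
    ∀ a, fderiv ℝ (fun q => gip (bcvMet m l) (φ q) (V q) (W q)) u (Pi.single a 1) =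
      gip (bcvMet m l) (φ u) (covAlong (bcvMet m l) φ V a u) (W u)
      + gip (bcvMet m l) (φ u) (V u) (covAlong (bcvMet m l) φ W a u) :=
  gip_compat _ (bcv_symm m l) φ V W u (bcv_det m l _ (S.dom u)) (bcv_diff m l _ (S.dom u))
    (fun k => smooth_diff (S.imm.1 k) u) hV hW

lemma Setup.cov_diff (S : Setup m l φ ξ) (u : Pt 2) (V : Pt 2 → Pt 3)
    (hV : ∀ k, ContDiff ℝ (⊤ : ℕ∞) (fun q => V q k)) (a : Fin 2) (k : Fin 3) :
    DifferentiableAt ℝ (fun q => covAlong (bcvMet m l) φ V a q k) u :=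
  (covAlong_diff _ φ V u S.imm.1 hV (S.hΓ u) a k).differentiableAt

lemma Setup.dfff (S : Setup m l φ ξ) (u : Pt 2) (a b : Fin 2) :
    DifferentiableAt ℝ (fun q => fff (bcvMet m l) φ q a b) u ∧
    ∀ c, fderiv ℝ (fun q => fff (bcvMet m l) φ q a b) u (Pi.single c 1) =
      gip (bcvMet m l) (φ u) (covAlong (bcvMet m l) φ (fr φ a) c u) (dmap φ u b)
      + gip (bcvMet m l) (φ u) (covAlong (bcvMet m l) φ (fr φ b) c u) (dmap φ u a) := by
  have h := S.compat u (fr φ a) (fr φ b) (fun k => smooth_diff (S.fr_smooth a k) u)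
    (fun k => smooth_diff (S.fr_smooth b k) u)
  refine ⟨h.1, fun c => ?_⟩
  rw [gip_comm _ (bcv_symm m l) (φ u) (covAlong (bcvMet m l) φ (fr φ b) c u)]
  exact h.2 c

lemma Setup.tor (S : Setup m l φ ξ) (u : Pt 2) (a b : Fin 2) :
    covAlong (bcvMet m l) φ (fr φ b) a u = covAlong (bcvMet m l) φ (fr φ a) b u :=
  torsion_free _ (bcv_symm m l) φ S.imm.1 u a b

lemma Setup.koszulG (S : Setup m l φ ξ) (u : Pt 2) (r i j : Fin 2) :
    ∑ k, fff (bcvMet m l) φ u r k * christoffel (fff (bcvMet m l) φ) u k i j =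
      gip (bcvMet m l) (φ u) (covAlong (bcvMet m l) φ (fr φ j) i u) (dmap φ u r) := by
  rw [koszul _ u (S.det_unit u), (S.dfff u _ _).2, (S.dfff u _ _).2, (S.dfff u _ _).2,
    S.tor u j i, S.tor u r i, S.tor u r j]
  ring

lemma sff_def (g : Met 3) (u : Pt 2) (a b : Fin 2) :
    sff g φ ξ u a b = gip g (φ u) (covAlong g φ (fr φ b) a u) (ξ u) := rfl

lemma Setup.sff_symm (S : Setup m l φ ξ) (u : Pt 2) (a b : Fin 2) :
    sff (bcvMet m l) φ ξ u a b = sff (bcvMet m l) φ ξ u b a := by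
  rw [sff_def, S.tor]; rfl

lemma Setup.gauss (S : Setup m l φ ξ) (u : Pt 2) (a b : Fin 2) :
    covAlong (bcvMet m l) φ (fr φ b) a u =
      ∑ c, christoffel (fff (bcvMet m l) φ) u c a b • dmap φ u c
       + sff (bcvMet m l) φ ξ u a b • ξ u := by
  apply S.ext u
  · intro d
    rw [← S.koszulG u d a b, gip_add_left, gip_smul_left, S.nor.2.2, gip_sum_left]
    simp only [gip_smul_left, ← fff_def, mul_zero, add_zero]
    refine Finset.sum_congr rfl fun k _ => ?_
    rw [fff_symm]; ring
  · rw [gip_add_left, gip_smul_left, S.nor.2.1, gip_sum_left, ← sff_def]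
    simp only [gip_smul_left, gip_comm _ (bcv_symm m l) (φ u) (dmap φ u _), S.nor.2.2]
    simp

lemma Setup.tension_eq (S : Setup m l φ ξ) (u : Pt 2) :
    tension (bcvMet m l) φ u = (2 * meanCurv (bcvMet m l) φ ξ u) • ξ u := by
  ext k
  have h : ∀ a b, (fderiv ℝ (fun q => dmap φ q b k) u (Pi.single a 1)
      - ∑ c, christoffel (fff (bcvMet m l) φ) u c a b * dmap φ u c k
      + ∑ i, ∑ j, christoffel (bcvMet m l) (φ u) k i j * dmap φ u a i * dmap φ u b j)
      = sff (bcvMet m l) φ ξ u a b * ξ u k := by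
    intro a b
    have := congrFun (S.gauss u a b) k
    simp only [covAlong, fr, Pi.add_apply, Finset.sum_apply, Pi.smul_apply, smul_eq_mul] at this
    linarith
  simp only [tension, h]
  simp only [meanCurv, shapeOp, Pi.smul_apply, smul_eq_mul, Fin.sum_univ_two]
  rw [S.sff_symm u 1 0]
  push_cast
  ring

end

noncomputable section
open scoped BigOperators

variable {m l : ℝ} {φ ξ : Pt 2 → Pt 3}

lemma Setup.inv_symm (_S : Setup m l φ ξ) (u : Pt 2) (a b : Fin 2) :
    (fff (bcvMet m l) φ u)⁻¹ a b = (fff (bcvMet m l) φ u)⁻¹ b a := by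
  have h : (fff (bcvMet m l) φ u).transpose = fff (bcvMet m l) φ u := by
    ext i j; exact fff_symm m l φ u j i
  conv_lhs => rw [← h, ← Matrix.transpose_nonsing_inv]
  rfl

lemma Setup.inv_mul (S : Setup m l φ ξ) (u : Pt 2) (a b : Fin 2) :
    ∑ c, fff (bcvMet m l) φ u a c * (fff (bcvMet m l) φ u)⁻¹ c b = if a = b then 1 else 0 := by
  have := congrFun (congrFun (Matrix.mul_nonsing_inv _ (S.det_unit u)) a) b
  rw [Matrix.mul_apply, Matrix.one_apply] at this
  exact this

lemma Setup.ξ_diff (S : Setup m l φ ξ) (u : Pt 2) (k : Fin 3) :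
    DifferentiableAt ℝ (fun q => ξ q k) u := smooth_diff (S.nor.1 k) u

lemma Setup.wein_nor (S : Setup m l φ ξ) (u : Pt 2) (b : Fin 2) :
    gip (bcvMet m l) (φ u) (covAlong (bcvMet m l) φ ξ b u) (ξ u) = 0 := by
  have h := (S.compat u ξ ξ (S.ξ_diff u) (S.ξ_diff u)).2 b
  simp only [S.nor.2.1] at h
  rw [gip_comm _ (bcv_symm m l) (φ u) (ξ u)] at h
  simp at h
  linarith

lemma Setup.wein_tan (S : Setup m l φ ξ) (u : Pt 2) (b c : Fin 2) :
    gip (bcvMet m l) (φ u) (covAlong (bcvMet m l) φ ξ b u) (dmap φ u c)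
      = - sff (bcvMet m l) φ ξ u b c := by
  have h := (S.compat u ξ (fr φ c) (S.ξ_diff u) (fun k => smooth_diff (S.fr_smooth c k) u)).2 b
  have h0 : (fun q => gip (bcvMet m l) (φ q) (ξ q) (fr φ c q)) = fun _ => 0 := by
    ext q; exact S.nor.2.2 q c
  rw [h0, gip_comm _ (bcv_symm m l) (φ u) (ξ u)] at h
  simp at h
  rw [sff_def]
  change 0 = gip (bcvMet m l) (φ u) (covAlong (bcvMet m l) φ ξ b u) (dmap φ u c) + _ at h
  linarith

lemma Setup.wein (S : Setup m l φ ξ) (u : Pt 2) (b : Fin 2) :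
    covAlong (bcvMet m l) φ ξ b u = ∑ d, (- shapeOp (bcvMet m l) φ ξ u d b) • dmap φ u d := by
  apply S.ext u
  · intro e
    rw [S.wein_tan, gip_sum_left]
    simp only [gip_smul_left, ← fff_def, shapeOp, Fin.sum_univ_two]
    have h0 := S.inv_mul u e 0
    have h1 := S.inv_mul u e 1
    rw [Fin.sum_univ_two] at h0 h1
    rw [fff_symm m l φ u 0 e, fff_symm m l φ u 1 e, S.sff_symm u b e]
    fin_cases e <;> simp at h0 h1 ⊢ <;> 
      linear_combination (sff (bcvMet m l) φ ξ u 0 b) * h0 + (sff (bcvMet m l) φ ξ u 1 b) * h1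
  · rw [S.wein_nor, gip_sum_left]
    simp only [gip_smul_left, gip_comm _ (bcv_symm m l) (φ u) (dmap φ u _), S.nor.2.2]
    simp

/-- second covariant derivative of ξ: normal component -/
lemma Setup.dd_nor (S : Setup m l φ ξ) (u : Pt 2) (a b : Fin 2) :
    gip (bcvMet m l) (φ u)
      (covAlong (bcvMet m l) φ (covAlong (bcvMet m l) φ ξ b) a u) (ξ u)
      = - ∑ d, shapeOp (bcvMet m l) φ ξ u d b * sff (bcvMet m l) φ ξ u a d := by
  have h := (S.compat u (covAlong (bcvMet m l) φ ξ b) ξ (S.cov_diff u ξ S.nor.1 b) (S.ξ_diff u)).2 a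
  have h0 : (fun q => gip (bcvMet m l) (φ q) (covAlong (bcvMet m l) φ ξ b q) (ξ q)) = fun _ => 0 := by
    ext q; exact S.wein_nor q b
  rw [h0] at h
  simp only [fderiv_fun_const, Pi.zero_apply, _root_.zero_apply] at h
  have h1 : gip (bcvMet m l) (φ u) (covAlong (bcvMet m l) φ ξ b u) (covAlong (bcvMet m l) φ ξ a u) =
     ∑ d, shapeOp (bcvMet m l) φ ξ u d b * sff (bcvMet m l) φ ξ u a d := by
    conv_lhs => rw [S.wein u b, gip_sum_left]
    simp only [gip_smul_left, gip_comm _ (bcv_symm m l) (φ u) (dmap φ u _), S.wein_tan]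
    refine Finset.sum_congr rfl fun d _ => by ring
  linarith

lemma Setup.sff_diff (S : Setup m l φ ξ) (u : Pt 2) (b c : Fin 2) :
    DifferentiableAt ℝ (fun q => sff (bcvMet m l) φ ξ q b c) u :=
  (S.compat u (covAlong (bcvMet m l) φ (fr φ c) b) ξ (S.cov_diff u _ (S.fr_smooth c) b) (S.ξ_diff u)).1

lemma Setup.cross (S : Setup m l φ ξ) (u : Pt 2) (a b c : Fin 2) :
    gip (bcvMet m l) (φ u) (covAlong (bcvMet m l) φ (fr φ c) a u) (covAlong (bcvMet m l) φ ξ b u) =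
     - ∑ d, christoffel (fff (bcvMet m l) φ) u d a c * sff (bcvMet m l) φ ξ u b d := by
  rw [S.gauss, gip_add_left, gip_smul_left, gip_comm _ (bcv_symm m l) (φ u) (ξ u), S.wein_nor,
    gip_sum_left]
  simp only [gip_smul_left, gip_comm _ (bcv_symm m l) (φ u) (dmap φ u _), S.wein_tan]
  simp

/-- tangential component -/
lemma Setup.dd_tan (S : Setup m l φ ξ) (u : Pt 2) (a b c : Fin 2) :
    gip (bcvMet m l) (φ u)
      (covAlong (bcvMet m l) φ (covAlong (bcvMet m l) φ ξ b) a u) (dmap φ u c)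
      = - fderiv ℝ (fun q => sff (bcvMet m l) φ ξ q b c) u (Pi.single a 1)
        + ∑ d, christoffel (fff (bcvMet m l) φ) u d a c * sff (bcvMet m l) φ ξ u b d := by
  have h := (S.compat u (covAlong (bcvMet m l) φ ξ b) (fr φ c) (S.cov_diff u ξ S.nor.1 b)
    (fun k => smooth_diff (S.fr_smooth c k) u)).2 a
  have h0 : (fun q => gip (bcvMet m l) (φ q) (covAlong (bcvMet m l) φ ξ b q) (fr φ c q))
      = fun q => - sff (bcvMet m l) φ ξ q b c := by
    ext q; exact S.wein_tan q b c
  rw [h0, gip_comm _ (bcv_symm m l) (φ u) (covAlong (bcvMet m l) φ ξ b u), S.cross, fderiv_fun_neg] at h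
  simp only [_root_.neg_apply] at h
  change _ = gip (bcvMet m l) (φ u)
      (covAlong (bcvMet m l) φ (covAlong (bcvMet m l) φ ξ b) a u) (dmap φ u c) + _ at h
  linarith

lemma Setup.codazzi (S : Setup m l φ ξ) (u : Pt 2) (a b c : Fin 2) :
    fderiv ℝ (fun q => sff (bcvMet m l) φ ξ q b c) u (Pi.single a 1)
      = fderiv ℝ (fun q => sff (bcvMet m l) φ ξ q a b) u (Pi.single c 1)
      + gip (bcvMet m l) (φ u) (curvPt (bcvMet m l) (φ u) (dmap φ u a) (dmap φ u c) (dmap φ u b)) (ξ u)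
      - ∑ d, christoffel (fff (bcvMet m l) φ) u d c b * sff (bcvMet m l) φ ξ u a d
      + ∑ d, christoffel (fff (bcvMet m l) φ) u d a b * sff (bcvMet m l) φ ξ u c d := by
  have hh : ∀ a c, fderiv ℝ (fun q => sff (bcvMet m l) φ ξ q c b) u (Pi.single a 1) =
     gip (bcvMet m l) (φ u)
      (covAlong (bcvMet m l) φ (covAlong (bcvMet m l) φ (fr φ b) c) a u) (ξ u)
      - ∑ d, christoffel (fff (bcvMet m l) φ) u d c b * sff (bcvMet m l) φ ξ u a d := by
    intro a c
    have h := (S.compat u (covAlong (bcvMet m l) φ (fr φ b) c) ξ (S.cov_diff u _ (S.fr_smooth b) c)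
      (S.ξ_diff u)).2 a
    rw [S.cross] at h
    rw [sub_eq_add_neg, ← h]
    rfl
  have hs : (fun q => sff (bcvMet m l) φ ξ q b c) = (fun q => sff (bcvMet m l) φ ξ q c b) := by
    ext q; exact S.sff_symm q b c
  have hR := ricci_identity (bcvMet m l) (bcv_symm m l) φ (fr φ b) u S.imm.1 (S.fr_smooth b) (S.hΓ u) a c
  rw [hs, hh, hh]
  change _ = curvPt (bcvMet m l) (φ u) (dmap φ u a) (dmap φ u c) (dmap φ u b) at hR
  rw [← hR, gip_sub_left]
  ring

lemma Setup.complete (S : Setup m l φ ξ) (u : Pt 2) (v : Pt 3) :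
    v = ∑ a, ∑ b, ((fff (bcvMet m l) φ u)⁻¹ a b * gip (bcvMet m l) (φ u) (dmap φ u b) v) • dmap φ u a
      + gip (bcvMet m l) (φ u) (ξ u) v • ξ u := by
  apply S.ext u
  · intro e
    simp only [gip_add_left, gip_smul_left, ← fff_def, S.nor.2.2, Fin.sum_univ_two]
    have h0 := S.inv_mul u e 0
    have h1 := S.inv_mul u e 1
    rw [Fin.sum_univ_two] at h0 h1
    rw [fff_symm m l φ u 0 e, fff_symm m l φ u 1 e, gip_comm _ (bcv_symm m l) (φ u) v]
    fin_cases e <;> simp at h0 h1 ⊢ <;> 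
      linear_combination (-gip (bcvMet m l) (φ u) (dmap φ u 0) v) * h0
        + (-gip (bcvMet m l) (φ u) (dmap φ u 1) v) * h1
  · simp only [gip_add_left, gip_sum_left, gip_smul_left, S.nor.2.1,
      gip_comm _ (bcv_symm m l) (φ u) (dmap φ u _) (ξ u), S.nor.2.2]
    rw [gip_comm _ (bcv_symm m l)]
    simp

lemma Setup.proj (S : Setup m l φ ξ) (u : Pt 2) (γ δ : Fin 3) :
    ∑ a, ∑ b, (fff (bcvMet m l) φ u)⁻¹ a b * th m l (φ u) (dmap φ u a) γ * th m l (φ u) (dmap φ u b) δ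
      + th m l (φ u) (ξ u) γ * th m l (φ u) (ξ u) δ = if γ = δ then 1 else 0 := by
  have hg : ∀ v, gip (bcvMet m l) (φ u) v (unth m l (φ u) (Pi.single δ 1)) = th m l (φ u) v δ := by
    intro v
    rw [gip_th, th_unth m l _ (S.dom u)]
    fin_cases δ <;> simp
  have h := congrArg (fun v => th m l (φ u) v γ) (S.complete u (unth m l (φ u) (Pi.single δ 1)))
  simp only [hg, th_unth m l _ (S.dom u), Fin.sum_univ_two, th_add, th_smul] at h
  rw [Pi.single_apply] at h
  simp only [Fin.sum_univ_two]
  linear_combination -h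

lemma Setup.trace (S : Setup m l φ ξ) (u : Pt 2) (v w : Pt 3) :
    ∑ a, ∑ b, (fff (bcvMet m l) φ u)⁻¹ a b *
        gip (bcvMet m l) (φ u) (curvPt (bcvMet m l) (φ u) (dmap φ u a) v (dmap φ u b)) w
      + gip (bcvMet m l) (φ u) (curvPt (bcvMet m l) (φ u) (ξ u) v (ξ u)) w
      = - ricci (bcvMet m l) (φ u) v w := by
  have hP := S.proj u
  simp only [bcv_ricci m l _ (S.dom u), gip_th, bcv_curv m l _ (S.dom u), th_unth m l _ (S.dom u),
    Fin.sum_univ_two] at hP ⊢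
  generalize th m l (φ u) v = v
  generalize th m l (φ u) w = w
  generalize th m l (φ u) (ξ u) = c at *
  generalize th m l (φ u) (dmap φ u 0) = f0 at *
  generalize th m l (φ u) (dmap φ u 1) = f1 at *
  generalize (fff (bcvMet m l) φ u)⁻¹ = J at *
  have k00 := hP 0 0
  have k01 := hP 0 1
  have k02 := hP 0 2
  have k10 := hP 1 0
  have k11 := hP 1 1
  have k12 := hP 1 2
  have k20 := hP 2 0
  have k21 := hP 2 1
  have k22 := hP 2 2
  clear hP
  simp at k00 k01 k02 k10 k11 k12 k20 k21 k22
  simp [Rf]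
  linear_combination (-((4*m-3*l^2/4) * v 1 * w 1) - l^2/4 * v 2 * w 2) * k00
    + (-((4*m-3*l^2/4) * v 0 * w 0) - l^2/4 * v 2 * w 2) * k11
    + (-(l^2/4 * v 0 * w 0) - l^2/4 * v 1 * w 1) * k22
    + ((4*m-3*l^2/4) * v 1 * w 0) * k01 + ((4*m-3*l^2/4) * v 0 * w 1) * k10
    + (l^2/4 * v 2 * w 0) * k02 + (l^2/4 * v 2 * w 1) * k12
    + (l^2/4 * v 0 * w 2) * k20 + (l^2/4 * v 1 * w 2) * k21

end

noncomputable section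
open scoped BigOperators

variable {m l : ℝ} {φ ξ : Pt 2 → Pt 3}

lemma Setup.inv_explicit (_S : Setup m l φ ξ) (u : Pt 2) :
    ∃ t : ℝ, (t = (fff (bcvMet m l) φ u 0 0 * fff (bcvMet m l) φ u 1 1
      - fff (bcvMet m l) φ u 0 1 ^ 2)⁻¹) ∧
      (fff (bcvMet m l) φ u)⁻¹ 0 0 = t * fff (bcvMet m l) φ u 1 1 ∧
      (fff (bcvMet m l) φ u)⁻¹ 0 1 = - (t * fff (bcvMet m l) φ u 0 1) ∧
      (fff (bcvMet m l) φ u)⁻¹ 1 0 = - (t * fff (bcvMet m l) φ u 0 1) ∧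
      (fff (bcvMet m l) φ u)⁻¹ 1 1 = t * fff (bcvMet m l) φ u 0 0 := by
  refine ⟨_, rfl, ?_⟩
  have hs := fff_symm m l φ u 1 0
  simp only [Matrix.inv_def, Ring.inverse_eq_inv', Matrix.adjugate_fin_two, Matrix.det_fin_two, hs]
  simp [sq]

lemma Setup.dG (S : Setup m l φ ξ) (u : Pt 2) (a b c : Fin 2) :
    fderiv ℝ (fun q => fff (bcvMet m l) φ q a b) u (Pi.single c 1) =
      ∑ d, fff (bcvMet m l) φ u b d * christoffel (fff (bcvMet m l) φ) u d c a
      + ∑ d, fff (bcvMet m l) φ u a d * christoffel (fff (bcvMet m l) φ) u d c b := by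
  rw [(S.dfff u a b).2 c, S.koszulG, S.koszulG]

lemma Setup.mean_poly (S : Setup m l φ ξ) (H₀ : ℝ)
    (hH : ∀ u, meanCurv (bcvMet m l) φ ξ u = H₀) (u : Pt 2) :
    fff (bcvMet m l) φ u 1 1 * sff (bcvMet m l) φ ξ u 0 0
      - 2 * (fff (bcvMet m l) φ u 0 1 * sff (bcvMet m l) φ ξ u 0 1)
      + fff (bcvMet m l) φ u 0 0 * sff (bcvMet m l) φ ξ u 1 1
      - 2 * H₀ * (fff (bcvMet m l) φ u 0 0 * fff (bcvMet m l) φ u 1 1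
      - fff (bcvMet m l) φ u 0 1 * fff (bcvMet m l) φ u 0 1) = 0 := by
  obtain ⟨t, ht, h00, h01, h10, h11⟩ := S.inv_explicit u
  have hd := S.det_ne u
  have h := hH u
  simp only [meanCurv, shapeOp, Fin.sum_univ_two, h00, h01, h10, h11, S.sff_symm u 1 0] at h
  have ht' : t * (fff (bcvMet m l) φ u 0 0 * fff (bcvMet m l) φ u 1 1
      - fff (bcvMet m l) φ u 0 1 ^ 2) = 1 := by rw [ht]; exact inv_mul_cancel₀ hd
  rw [← h]
  push_cast
  linear_combination (-(fff (bcvMet m l) φ u 1 1 * sff (bcvMet m l) φ ξ u 0 0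
      - 2 * (fff (bcvMet m l) φ u 0 1 * sff (bcvMet m l) φ ξ u 0 1)
      + fff (bcvMet m l) φ u 0 0 * sff (bcvMet m l) φ ξ u 1 1)) * ht'

lemma Setup.dH (S : Setup m l φ ξ) (H₀ : ℝ)
    (hH : ∀ u, meanCurv (bcvMet m l) φ ξ u = H₀) (u : Pt 2) (c : Fin 2) :
    ∑ a, ∑ b, (fff (bcvMet m l) φ u)⁻¹ a b *
      (fderiv ℝ (fun q => sff (bcvMet m l) φ ξ q a b) u (Pi.single c 1)
       - 2 * ∑ d, christoffel (fff (bcvMet m l) φ) u d c b * sff (bcvMet m l) φ ξ u a d) = 0 := by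
  obtain ⟨t, ht, h00, h01, h10, h11⟩ := S.inv_explicit u
  have hp := S.mean_poly H₀ hH
  have hG := fun a b => (S.dfff u a b).1.hasFDerivAt
  have hh := fun a b => (S.sff_diff u a b).hasFDerivAt
  have hd := ((((hG 1 1).mul (hh 0 0)).sub (((hG 0 1).mul (hh 0 1)).const_mul 2)).add
    ((hG 0 0).mul (hh 1 1))).sub ((((hG 0 0).mul (hG 1 1)).sub ((hG 0 1).mul (hG 0 1))).const_mul (2 * H₀))
  have hz : HasFDerivAt (fun _ : Pt 2 => (0:ℝ)) (0 : Pt 2 →L[ℝ] ℝ) u := hasFDerivAt_const _ _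
  have he := hd.unique (hz.congr_of_eventuallyEq (Filter.Eventually.of_forall hp))
  have he' := congrArg (fun L : Pt 2 →L[ℝ] ℝ => L (Pi.single c 1)) he
  simp only [_root_.sub_apply, _root_.add_apply, _root_.smul_apply, smul_eq_mul, _root_.zero_apply,
    S.dG, Fin.sum_univ_two] at he'
  have hpu := hp u
  have hsd : fderiv ℝ (fun q => sff (bcvMet m l) φ ξ q 1 0) u = fderiv ℝ (fun q => sff (bcvMet m l) φ ξ q 0 1) u := by
    congr 1; ext q; exact S.sff_symm q 1 0
  simp only [Fin.sum_univ_two, h00, h01, h10, h11, S.sff_symm u 1 0, hsd]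
  simp only [fff_symm m l φ u 1 0] at he'
  linear_combination t * he' - 2 * t * (christoffel (fff (bcvMet m l) φ) u 0 c 0 + christoffel (fff (bcvMet m l) φ) u 1 c 1) * hpu

/-- the reduced bitension -/
def Wv (m l : ℝ) (φ ξ : Pt 2 → Pt 3) (u : Pt 2) : Pt 3 :=
  ∑ a, ∑ b, (fff (bcvMet m l) φ u)⁻¹ a b •
    (covAlong (bcvMet m l) φ (covAlong (bcvMet m l) φ ξ b) a u
      - ∑ c, christoffel (fff (bcvMet m l) φ) u c a b • covAlong (bcvMet m l) φ ξ c u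
      - curvPt (bcvMet m l) (φ u) (dmap φ u a) (ξ u) (dmap φ u b))

lemma covAlong_smul (g : Met 3) (φ V : Pt 2 → Pt 3) (c : ℝ) (a : Fin 2)
    (hV : ∀ k u, DifferentiableAt ℝ (fun q => V q k) u) :
    covAlong g φ (fun q => c • V q) a = fun u => c • covAlong g φ V a u := by
  ext u k
  simp only [covAlong, Pi.smul_apply, smul_eq_mul]
  rw [fderiv_const_mul (hV k u), mul_add, Finset.mul_sum]
  simp only [Finset.mul_sum, _root_.smul_apply, smul_eq_mul]
  congr 1
  refine Finset.sum_congr rfl fun i _ => Finset.sum_congr rfl fun j _ => by ring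

lemma bcv_curv_smul (m l : ℝ) (p : Pt 3) (hF : bcvF m p ≠ 0) (v w z : Pt 3) (c : ℝ) (k : Fin 3) :
    curvPt (bcvMet m l) p v (c • w) z k = c * curvPt (bcvMet m l) p v w z k := by
  rw [bcv_curv m l p hF, bcv_curv m l p hF]
  fin_cases k <;> simp [unth, Rf, th_smul] <;> ring

lemma Setup.bitension_eq (S : Setup m l φ ξ) (H₀ : ℝ)
    (hH : ∀ u, meanCurv (bcvMet m l) φ ξ u = H₀) (u : Pt 2) :
    bitension (bcvMet m l) φ u = (2 * H₀) • Wv m l φ ξ u := by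
  have ht : tension (bcvMet m l) φ = fun q => (2 * H₀) • ξ q := by
    ext1 q; rw [S.tension_eq, hH]
  ext k
  simp only [bitension, ht, covAlong_smul _ φ ξ (2 * H₀) _ (fun k u => S.ξ_diff u k),
    bcv_curv_smul m l _ (S.dom u)]
  simp only [covAlong_smul _ φ (covAlong (bcvMet m l) φ ξ _) (2 * H₀) _
    (fun k u => S.cov_diff u ξ S.nor.1 _ k)]
  simp only [Wv, Fin.sum_univ_two, Pi.smul_apply, Pi.add_apply, Pi.sub_apply, smul_eq_mul]
  ring

lemma bcv_curv_ξξ (m l : ℝ) (p : Pt 3) (hF : bcvF m p ≠ 0) (v w : Pt 3) :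
    curvPt (bcvMet m l) p v v w = 0 := by
  rw [bcv_curv m l p hF]
  ext k
  fin_cases k <;> simp [unth, Rf, -mul_eq_zero] <;> ring

lemma bcv_curv_skew (m l : ℝ) (p : Pt 3) (hF : bcvF m p ≠ 0) (v w z : Pt 3) :
    gip (bcvMet m l) p (curvPt (bcvMet m l) p v w z) z = 0 := by
  rw [bcv_curv m l p hF, gip_th, th_unth m l p hF]
  simp [Rf]; ring

lemma Setup.W_nor (S : Setup m l φ ξ) (u : Pt 2) :
    gip (bcvMet m l) (φ u) (Wv m l φ ξ u) (ξ u)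
      = - normA2 (bcvMet m l) φ ξ u + ricci (bcvMet m l) (φ u) (ξ u) (ξ u) := by
  have ht := S.trace u (ξ u) (ξ u)
  rw [bcv_curv_ξξ m l _ (S.dom u), gip_zero_left, add_zero] at ht
  simp only [Wv, gip_sum_left, gip_smul_left, gip_sub_left, S.dd_nor, S.wein_nor]
  simp only [mul_sub, Finset.sum_sub_distrib, ht]
  simp only [normA2, shapeOp, Fin.sum_univ_two, S.sff_symm u 1 0, S.inv_symm u 1 0]
  ring

lemma Setup.W_tan (S : Setup m l φ ξ) (H₀ : ℝ)
    (hH : ∀ u, meanCurv (bcvMet m l) φ ξ u = H₀) (u : Pt 2) (c : Fin 2) :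
    gip (bcvMet m l) (φ u) (Wv m l φ ξ u) (dmap φ u c)
      = 2 * ricci (bcvMet m l) (φ u) (ξ u) (dmap φ u c) := by
  have ht := S.trace u (ξ u) (dmap φ u c)
  rw [bcv_curv_ξξ m l _ (S.dom u), gip_zero_left, add_zero] at ht
  have ht2 := S.trace u (dmap φ u c) (ξ u)
  rw [bcv_curv_skew m l _ (S.dom u), add_zero] at ht2
  have hr : ricci (bcvMet m l) (φ u) (dmap φ u c) (ξ u) = ricci (bcvMet m l) (φ u) (ξ u) (dmap φ u c) := by
    rw [bcv_ricci m l _ (S.dom u), bcv_ricci m l _ (S.dom u)]; ring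
  rw [hr] at ht2
  have hd := S.dH H₀ hH u c
  simp only [Wv, gip_sum_left, gip_smul_left, gip_sub_left, S.dd_tan, S.wein_tan]
  simp only [S.codazzi u _ _ c]
  have hΓ := fun k i j => christoffel_symm (fff (bcvMet m l) φ) (fff_symm m l φ) u k i j
  have e1 : ∀ d a, christoffel (fff (bcvMet m l) φ) u d a c = christoffel (fff (bcvMet m l) φ) u d c a :=
    fun d a => hΓ d a c
  have hsc : ∀ d, sff (bcvMet m l) φ ξ u d c = sff (bcvMet m l) φ ξ u c d := fun d => S.sff_symm u d c
  simp only [Fin.sum_univ_two] at ht ht2 hd ⊢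
  simp only [e1 _ 0, e1 _ 1, hsc]
  simp only [S.sff_symm u 1 0, S.inv_symm u 1 0] at ht ht2 hd ⊢
  linear_combination -ht - ht2 - hd

end

section

variable {m l : ℝ} {φ ξ : Pt 2 → Pt 3}

lemma push_sum (φ : Pt 2 → Pt 3) (u v : Pt 2) :
    push φ u v = v 0 • dmap φ u 0 + v 1 • dmap φ u 1 := by
  ext k
  simp only [push, dmap, Pi.add_apply, Pi.smul_apply, smul_eq_mul]
  rw [fderiv_single_sum, Fin.sum_univ_two]

lemma Setup.W_tan_push (S : Setup m l φ ξ) (H₀ : ℝ)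
    (hH : ∀ u, meanCurv (bcvMet m l) φ ξ u = H₀) (u v : Pt 2) :
    gip (bcvMet m l) (φ u) (Wv m l φ ξ u) (push φ u v)
      = 2 * ricci (bcvMet m l) (φ u) (ξ u) (push φ u v) := by
  rw [push_sum, gip_add_right, gip_smul_right, gip_smul_right, S.W_tan H₀ hH, S.W_tan H₀ hH]
  simp only [bcv_ricci m l _ (S.dom u), th_add, th_smul, Pi.add_apply, Pi.smul_apply, smul_eq_mul]
  ring

lemma Setup.nor_push (S : Setup m l φ ξ) (u v : Pt 2) :
    gip (bcvMet m l) (φ u) (ξ u) (push φ u v) = 0 := by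
  rw [push_sum, gip_add_right, gip_smul_right, gip_smul_right, S.nor.2.2, S.nor.2.2]
  ring

end

/-- Let `Σ` be a surface of constant mean curvature `H₀` in a BCV space
`M³_{m,l}`, with adapted orthonormal frame `{e₁ = a₁^γ E_γ, e₂ = a₂^γ E_γ, ξ = c^γ E_γ}`,
`ξ` the unit normal.  Then `(Ric(ξ))^⊤ = Ric(ξ,e₁) e₁ + Ric(ξ,e₂) e₂ =
(l² − 4m) c³ (a₁³ e₁ + a₂³ e₂)` and `Ric(ξ,ξ) = (4m − l²/2) + (l² − 4m)(c³)²`, and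
consequently `Σ` is biharmonic if and only if either `H₀ = 0`, or the system
`|A|² − (4m − l²/2) − (l² − 4m)(c³)² = 0`, `(l² − 4m) c³ a₁³ = 0`,
`(l² − 4m) c³ a₂³ = 0` holds. -/
theorem cmc_surface_in_BCV_biharmonic_system
    (m l : ℝ) (φ ξ e₁ e₂ : Pt 2 → Pt 3) (a₁ a₂ c : Pt 2 → Fin 3 → ℝ)
    (hφ : IsImmersion φ) (hdom : ∀ u, 0 < bcvF m (φ u))
    (he₁ : ∀ u, e₁ u = ∑ γ, a₁ u γ • bcvE m l γ (φ u))
    (he₂ : ∀ u, e₂ u = ∑ γ, a₂ u γ • bcvE m l γ (φ u))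
    (hc : ∀ u, ξ u = ∑ γ, c u γ • bcvE m l γ (φ u))
    (horth : ∀ u, gip (bcvMet m l) (φ u) (e₁ u) (e₁ u) = 1 ∧
      gip (bcvMet m l) (φ u) (e₂ u) (e₂ u) = 1 ∧
      gip (bcvMet m l) (φ u) (e₁ u) (e₂ u) = 0)
    (htan₁ : ∀ u, ∃ v : Pt 2, push φ u v = e₁ u)
    (htan₂ : ∀ u, ∃ v : Pt 2, push φ u v = e₂ u)
    (hξ : IsUnitNormal (bcvMet m l) φ ξ)
    (H₀ : ℝ) (hH : ∀ u, meanCurv (bcvMet m l) φ ξ u = H₀) :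
    (∀ u, (ricci (bcvMet m l) (φ u) (ξ u) (e₁ u)) • e₁ u
        + (ricci (bcvMet m l) (φ u) (ξ u) (e₂ u)) • e₂ u
      = ((l ^ 2 - 4 * m) * c u 2) • (a₁ u 2 • e₁ u + a₂ u 2 • e₂ u)) ∧
    (∀ u, ricci (bcvMet m l) (φ u) (ξ u) (ξ u)
      = (4 * m - l ^ 2 / 2) + (l ^ 2 - 4 * m) * c u 2 ^ 2) ∧
    (IsBiharmonic (bcvMet m l) φ ↔ H₀ = 0 ∨ ∀ u,
      normA2 (bcvMet m l) φ ξ u - (4 * m - l ^ 2 / 2) - (l ^ 2 - 4 * m) * c u 2 ^ 2 = 0 ∧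
      (l ^ 2 - 4 * m) * c u 2 * a₁ u 2 = 0 ∧
      (l ^ 2 - 4 * m) * c u 2 * a₂ u 2 = 0) := by
  have S : Setup m l φ ξ := ⟨hφ, fun u => (hdom u).ne', hξ⟩
  have t1 : ∀ u, th m l (φ u) (e₁ u) = a₁ u := fun u => by
    rw [he₁, bcvE_unth, th_unth m l _ (S.dom u)]
  have t2 : ∀ u, th m l (φ u) (e₂ u) = a₂ u := fun u => by
    rw [he₂, bcvE_unth, th_unth m l _ (S.dom u)]
  have t3 : ∀ u, th m l (φ u) (ξ u) = c u := fun u => by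
    rw [hc, bcvE_unth, th_unth m l _ (S.dom u)]
  have o1 : ∀ u, gip (bcvMet m l) (φ u) (ξ u) (e₁ u) = 0 := fun u => by
    obtain ⟨v, hv⟩ := htan₁ u
    rw [← hv, S.nor_push]
  have o2 : ∀ u, gip (bcvMet m l) (φ u) (ξ u) (e₂ u) = 0 := fun u => by
    obtain ⟨v, hv⟩ := htan₂ u
    rw [← hv, S.nor_push]
  have r1 : ∀ u, ricci (bcvMet m l) (φ u) (ξ u) (e₁ u) = (l ^ 2 - 4 * m) * c u 2 * a₁ u 2 := by
    intro u
    have h := o1 u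
    rw [gip_th, t1, t3] at h
    rw [bcv_ricci m l _ (S.dom u), t1, t3]
    linear_combination (4 * m - l ^ 2 / 2) * h
  have r2 : ∀ u, ricci (bcvMet m l) (φ u) (ξ u) (e₂ u) = (l ^ 2 - 4 * m) * c u 2 * a₂ u 2 := by
    intro u
    have h := o2 u
    rw [gip_th, t2, t3] at h
    rw [bcv_ricci m l _ (S.dom u), t2, t3]
    linear_combination (4 * m - l ^ 2 / 2) * h
  have r3 : ∀ u, ricci (bcvMet m l) (φ u) (ξ u) (ξ u)
      = (4 * m - l ^ 2 / 2) + (l ^ 2 - 4 * m) * c u 2 ^ 2 := by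
    intro u
    have h := hξ.2.1 u
    rw [gip_th, t3] at h
    rw [bcv_ricci m l _ (S.dom u), t3]
    linear_combination (4 * m - l ^ 2 / 2) * h
  have w1 : ∀ u, gip (bcvMet m l) (φ u) (Wv m l φ ξ u) (e₁ u)
      = 2 * ((l ^ 2 - 4 * m) * c u 2 * a₁ u 2) := fun u => by
    rw [← r1]
    obtain ⟨v, hv⟩ := htan₁ u
    rw [← hv, S.W_tan_push H₀ hH]
  have w2 : ∀ u, gip (bcvMet m l) (φ u) (Wv m l φ ξ u) (e₂ u)
      = 2 * ((l ^ 2 - 4 * m) * c u 2 * a₂ u 2) := fun u => by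
    rw [← r2]
    obtain ⟨v, hv⟩ := htan₂ u
    rw [← hv, S.W_tan_push H₀ hH]
  have w3 := fun u => S.W_nor u
  refine ⟨fun u => ?_, r3, ?_, ?_⟩
  · rw [r1, r2, smul_add, smul_smul, smul_smul]
  · intro hb
    by_cases h0 : H₀ = 0
    · exact Or.inl h0
    · refine Or.inr fun u => ?_
      have h := hb u
      rw [S.bitension_eq H₀ hH, smul_eq_zero] at h
      have hW : Wv m l φ ξ u = 0 := h.resolve_left (by simpa using h0)
      have x1 := w1 u
      have x2 := w2 u
      have x3 := w3 u
      rw [hW, gip_zero_left] at x1 x2 x3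
      rw [r3] at x3
      exact ⟨by linarith, by linarith, by linarith⟩
  · rintro (h0 | h) u
    · rw [S.bitension_eq H₀ hH, h0]
      simp
    · obtain ⟨y3, y1, y2⟩ := h u
      obtain ⟨q1, q2, q3⟩ := horth u
      have hli : LinearIndependent ℝ ![e₁ u, e₂ u, ξ u] := by
        rw [Fintype.linearIndependent_iff]
        intro d hd
        simp only [Fin.sum_univ_three] at hd
        simp at hd
        have k1 := gip_zero_left (bcvMet m l) (φ u) (e₁ u)
        have k2 := gip_zero_left (bcvMet m l) (φ u) (e₂ u)
        have k3 := gip_zero_left (bcvMet m l) (φ u) (ξ u)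
        have q3' := q3
        have o1' := o1 u
        have o2' := o2 u
        rw [gip_comm _ (bcv_symm m l)] at q3' o1' o2'
        rw [← hd] at k1 k2 k3
        simp only [gip_add_left, gip_smul_left, q1, q2, q3, q3', o1 u, o2 u, o1', o2',
          hξ.2.1 u] at k1 k2 k3
        intro i
        fin_cases i
        · simpa using k1
        · simpa using k2
        · simpa using k3
      have hW : Wv m l φ ξ u = 0 := by
        refine bcv_ndeg m l (φ u) _ (S.dom u) _ hli fun i => ?_
        fin_cases i
        · have := w1 u
          rw [y1, mul_zero] at this
          simpa using this
        · have := w2 u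
          rw [y2, mul_zero] at this
          simpa using this
        · have := w3 u
          rw [r3] at this
          have h' : gip (bcvMet m l) (φ u) (Wv m l φ ξ u) (ξ u) = 0 := by linarith
          simpa using h'
      rw [S.bitension_eq H₀ hH, hW, smul_zero]
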